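/- Let p be a prime with p \equiv 1 mod 8, and write p = u^2 + 2v^2 with v even, signs chosen so that u + v\sqrt{-2} is a p-adic unit (for a fixed square root of -2 in Z_p). Then \sum_{k=0}^{p-1} \binom{2k}{k}^2 ((1-\sqrt{2})/4)^{2k} \equiv (-1)^{(u-1)/2} (u + v\sqrt{-2}) mod p^2, where \sqrt{2} is a fixed square root of 2 in Z_p. -/

import Mathlib

open Finset

/-- A point of `Y² = 1 - 2ρR² + R⁴` over power series reducing to `(0, 1)`, on which the
invariant differential `dR / Y` pulls back to `ω`. -/
structure IsFormalPoint {K : Type*} [Field K] (ρ : K) (ω R Y : PowerSeries K) : Prop where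
  constR : PowerSeries.constantCoeff R = 0
  constY : PowerSeries.constantCoeff Y = 1
  curve : Y ^ 2 = 1 - 2 * PowerSeries.C ρ * R ^ 2 + R ^ 4
  derivR : PowerSeries.derivative K R = ω * Y

namespace IsFormalPoint

open PowerSeries

variable {K : Type*} [Field K] {ρ : K} {ω ω₁ ω₂ R Y R₁ Y₁ R₂ Y₂ : PowerSeries K}

lemma ne_zero_of_constantCoeff {f : PowerSeries K} {a : K} (h : constantCoeff f = a) (ha : a ≠ 0) :
    f ≠ 0 := by
  rintro rfl
  exact ha (by simpa using h.symm)

lemma derivY [CharZero K] (h : IsFormalPoint ρ ω R Y) :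
    derivative K Y = ω * (-2 * C ρ * R + 2 * R ^ 3) := by
  have hY : Y ≠ 0 := ne_zero_of_constantCoeff h.constY one_ne_zero
  have h2 : (2 : PowerSeries K) ≠ 0 := by
    have : (2 : PowerSeries K) = C (2 : K) := (map_ofNat C 2).symm
    rw [this]; simp
  have := congrArg (derivative K) h.curve
  simp only [map_add, map_sub, Derivation.leibniz, Derivation.leibniz_pow, derivative_C,
    Derivation.map_one_eq_zero, h.derivR, smul_eq_mul, nsmul_eq_mul] at this
  have e2 : derivative K (2 : PowerSeries K) = 0 := by
    have : (2 : PowerSeries K) = C (2 : K) := (map_ofNat C 2).symm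
    rw [this]; simp
  rw [e2] at this
  apply mul_left_cancel₀ (mul_ne_zero h2 hY)
  push_cast at this
  linear_combination this

protected lemma neg (h : IsFormalPoint ρ ω R Y) : IsFormalPoint ρ (-ω) (-R) Y where
  constR := by simp [h.constR]
  constY := h.constY
  curve := by rw [h.curve]; ring
  derivR := by rw [map_neg, h.derivR]; ring

protected lemma zero : IsFormalPoint ρ 0 0 1 where
  constR := by simp
  constY := by simp
  curve := by simp
  derivR := by simp

lemma add_aux [CharZero K] (h₁ : IsFormalPoint ρ ω₁ R₁ Y₁) (h₂ : IsFormalPoint ρ ω₂ R₂ Y₂)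
    (hR : R * (1 - R₁ ^ 2 * R₂ ^ 2) = R₁ * Y₂ + R₂ * Y₁)
    (hY : Y * (1 - R₁ ^ 2 * R₂ ^ 2) ^ 2 =
      (1 + R₁ ^ 2 * R₂ ^ 2) * (Y₁ * Y₂ - 2 * C ρ * R₁ * R₂) + 2 * R₁ * R₂ * (R₁ ^ 2 + R₂ ^ 2)) :
    IsFormalPoint ρ (ω₁ + ω₂) R Y where
  constR := by
    have := congrArg constantCoeff hR
    simpa [h₁.constR, h₂.constR] using this
  constY := by
    have := congrArg constantCoeff hY
    simpa [h₁.constR, h₂.constR, h₁.constY, h₂.constY] using this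
  curve := by
    have hD : (1 - R₁ ^ 2 * R₂ ^ 2) ≠ 0 :=
      ne_zero_of_constantCoeff (a := 1) (by simp [h₁.constR]) one_ne_zero
    have c₁ := h₁.curve
    have c₂ := h₂.curve
    apply mul_right_cancel₀ (pow_ne_zero 4 hD)
    have e1 : Y ^ 2 * (1 - R₁ ^ 2 * R₂ ^ 2) ^ 4 = (Y * (1 - R₁ ^ 2 * R₂ ^ 2) ^ 2) ^ 2 := by ring
    have e2 : (1 - 2 * C ρ * R ^ 2 + R ^ 4) * (1 - R₁ ^ 2 * R₂ ^ 2) ^ 4 =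
        (1 - R₁ ^ 2 * R₂ ^ 2) ^ 4 - 2 * C ρ * (R * (1 - R₁ ^ 2 * R₂ ^ 2)) ^ 2 *
          (1 - R₁ ^ 2 * R₂ ^ 2) ^ 2 + (R * (1 - R₁ ^ 2 * R₂ ^ 2)) ^ 4 := by ring
    have e3 : (R₁ * Y₂ + R₂ * Y₁) ^ 2 = R₁ ^ 2 * (1 - 2 * C ρ * R₂ ^ 2 + R₂ ^ 4) +
        R₂ ^ 2 * (1 - 2 * C ρ * R₁ ^ 2 + R₁ ^ 4) + 2 * R₁ * R₂ * (Y₁ * Y₂) := by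
      rw [← c₁, ← c₂]; ring
    have e4 : (Y₁ * Y₂) ^ 2 = (1 - 2 * C ρ * R₁ ^ 2 + R₁ ^ 4) * (1 - 2 * C ρ * R₂ ^ 2 + R₂ ^ 4) := by
      rw [← c₁, ← c₂]; ring
    have e5 : (R₁ * Y₂ + R₂ * Y₁) ^ 4 = ((R₁ * Y₂ + R₂ * Y₁) ^ 2) ^ 2 := by ring
    rw [e1, e2, hR, hY, e5, e3]
    generalize Y₁ * Y₂ = P at *
    linear_combination ((1 + R₁ ^ 2 * R₂ ^ 2) ^ 2 - 4 * R₁ ^ 2 * R₂ ^ 2) * e4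
  derivR := by
    have hD : (1 - R₁ ^ 2 * R₂ ^ 2) ≠ 0 :=
      ne_zero_of_constantCoeff (a := 1) (by simp [h₁.constR]) one_ne_zero
    apply mul_right_cancel₀ (pow_ne_zero 2 hD)
    have := congrArg (derivative K) hR
    simp only [map_add, map_sub, Derivation.leibniz, Derivation.leibniz_pow,
      Derivation.map_one_eq_zero, h₁.derivR, h₂.derivR, h₁.derivY, h₂.derivY, smul_eq_mul,
      nsmul_eq_mul] at this
    push_cast at this
    have e1 : (ω₁ + ω₂) * Y * (1 - R₁ ^ 2 * R₂ ^ 2) ^ 2 = (ω₁ + ω₂) * (Y * (1 - R₁ ^ 2 * R₂ ^ 2) ^ 2) := by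
      ring
    rw [e1, hY]
    have c₁ := h₁.curve
    have c₂ := h₂.curve
    linear_combination (1 - R₁ ^ 2 * R₂ ^ 2) * this + 
      2 * (ω₁ * R₁ * R₂ ^ 2 * Y₁ + ω₂ * R₁ ^ 2 * R₂ * Y₂) * hR +
      2 * ω₁ * R₁ * R₂ ^ 3 * c₁ + 2 * ω₂ * R₁ ^ 3 * R₂ * c₂

protected lemma add [CharZero K] (h₁ : IsFormalPoint ρ ω₁ R₁ Y₁) (h₂ : IsFormalPoint ρ ω₂ R₂ Y₂) :
    ∃ R Y, IsFormalPoint ρ (ω₁ + ω₂) R Y ∧ R * (1 - R₁ ^ 2 * R₂ ^ 2) = R₁ * Y₂ + R₂ * Y₁ := by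
  have hD : constantCoeff (1 - R₁ ^ 2 * R₂ ^ 2) ≠ 0 := by simp [h₁.constR]
  have hR : (R₁ * Y₂ + R₂ * Y₁) * (1 - R₁ ^ 2 * R₂ ^ 2)⁻¹ * (1 - R₁ ^ 2 * R₂ ^ 2) =
      R₁ * Y₂ + R₂ * Y₁ := by
    rw [mul_assoc, PowerSeries.inv_mul_cancel _ hD, mul_one]
  refine ⟨_, ((1 + R₁ ^ 2 * R₂ ^ 2) * (Y₁ * Y₂ - 2 * C ρ * R₁ * R₂) +
    2 * R₁ * R₂ * (R₁ ^ 2 + R₂ ^ 2)) * ((1 - R₁ ^ 2 * R₂ ^ 2)⁻¹) ^ 2, add_aux h₁ h₂ hR ?_, hR⟩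
  rw [mul_assoc, ← mul_pow ((1 - R₁ ^ 2 * R₂ ^ 2)⁻¹), PowerSeries.inv_mul_cancel _ hD, one_pow, mul_one]

/-- A formal point is determined by its differential. -/
lemma eq_of_eq [CharZero K] (h₁ : IsFormalPoint ρ ω R₁ Y₁) (h₂ : IsFormalPoint ρ ω R₂ Y₂) :
    R₁ = R₂ := by
  obtain ⟨R, Y, h, hR⟩ := h₁.add h₂.neg
  have hR0 : R = 0 := by
    apply derivative.ext
    · rw [h.derivR]; simp
    · rw [h.constR]; simp
  have h2 : (2 : K) ≠ 0 := two_ne_zero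
  have hx : (R₁ - R₂) * (R₁ + R₂) * (1 - R₁ ^ 2 * R₂ ^ 2) = 0 := by
    have e : R₁ * Y₂ = R₂ * Y₁ := by rw [hR0] at hR; linear_combination -hR
    have e2 : R₁ ^ 2 * Y₂ ^ 2 = R₂ ^ 2 * Y₁ ^ 2 := by
      rw [← mul_pow, e, mul_pow]
    rw [h₁.curve, h₂.curve] at e2
    linear_combination e2
  have hD : (1 - R₁ ^ 2 * R₂ ^ 2) ≠ 0 :=
    ne_zero_of_constantCoeff (a := 1) (by simp [h₁.constR]) one_ne_zero
  rcases mul_eq_zero.1 ((mul_eq_zero.1 hx).resolve_right hD) with h0 | h0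
  · exact sub_eq_zero.1 h0
  · have e : R₁ = - R₂ := eq_neg_of_add_eq_zero_left h0
    have e3 : R₂ * (Y₁ + Y₂) = 0 := by rw [hR0, e] at hR; linear_combination hR
    have hYY : Y₁ + Y₂ ≠ 0 :=
      ne_zero_of_constantCoeff (a := 2) (by simp [h₁.constY, h₂.constY]; norm_num) h2
    have := (mul_eq_zero.1 e3).resolve_right hYY
    rw [e, this, neg_zero]

lemma eq_of_eq' [CharZero K] (h₁ : IsFormalPoint ρ ω R₁ Y₁) (h₂ : IsFormalPoint ρ ω R₂ Y₂) :
    Y₁ = Y₂ := by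
  have e := h₁.eq_of_eq h₂
  subst e
  have e2 : (Y₁ - Y₂) * (Y₁ + Y₂) = 0 := by
    linear_combination h₁.curve - h₂.curve
  have hYY : Y₁ + Y₂ ≠ 0 :=
    ne_zero_of_constantCoeff (a := 2) (by simp [h₁.constY, h₂.constY]; norm_num) two_ne_zero
  exact sub_eq_zero.1 ((mul_eq_zero.1 e2).resolve_right hYY)

/-- Complex multiplication by `√-2`. -/
lemma sqrt_neg_two_mul [CharZero K] {s : K} (hρ : ρ ^ 2 = 2) (hs : s ^ 2 = -2)
    (h : IsFormalPoint ρ ω R Y) :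
    ∃ R' Y', IsFormalPoint ρ (C s * ω) R' Y' ∧ R' * Y = C s * R ∧
      Y' * Y ^ 2 = 1 - R ^ 4 := by
  have hc : constantCoeff Y ≠ 0 := by rw [h.constY]; exact one_ne_zero
  have hY : Y ≠ 0 := ne_zero_of_constantCoeff h.constY one_ne_zero
  have hR' : C s * R * Y⁻¹ * Y = C s * R := by
    rw [mul_assoc, PowerSeries.inv_mul_cancel _ hc, mul_one]
  have hY' : (1 - R ^ 4) * (Y⁻¹) ^ 2 * Y ^ 2 = 1 - R ^ 4 := by
    rw [mul_assoc, ← mul_pow, PowerSeries.inv_mul_cancel _ hc, one_pow, mul_one]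
  have hρ' : (C ρ : PowerSeries K) ^ 2 = 2 := by rw [← map_pow, hρ, map_ofNat]
  have hs' : (C s : PowerSeries K) ^ 2 = -2 := by rw [← map_pow, hs, map_neg, map_ofNat]
  have hcur := h.curve
  refine ⟨_, (1 - R ^ 4) * (Y⁻¹) ^ 2, ⟨?_, ?_, ?_, ?_⟩, hR', hY'⟩
  · simp [h.constR]
  · simp [h.constR, h.constY]
  · apply mul_right_cancel₀ (pow_ne_zero 4 hY)
    generalize C s * R * Y⁻¹ = A at *
    generalize (1 - R ^ 4) * (Y⁻¹) ^ 2 = B at *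
    have e1 : B ^ 2 * Y ^ 4 = (1 - R ^ 4) ^ 2 := by rw [← hY']; ring
    have e2 : (1 - 2 * C ρ * A ^ 2 + A ^ 4) * Y ^ 4 =
      (Y ^ 2) ^ 2 - 2 * C ρ * (C s ^ 2 * R ^ 2) * Y ^ 2 + (C s ^ 2 * R ^ 2) ^ 2 := by
      have : C s ^ 2 * R ^ 2 = A ^ 2 * Y ^ 2 := by rw [← mul_pow, ← hR']; ring
      rw [this]; ring
    rw [e1, e2, hs', hcur]
    linear_combination (4 * R ^ 4) * hρ'
  · apply mul_right_cancel₀ (pow_ne_zero 2 hY)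
    generalize C s * R * Y⁻¹ = A at *
    generalize (1 - R ^ 4) * (Y⁻¹) ^ 2 = B at *
    have := congrArg (derivative K) hR'
    simp only [Derivation.leibniz, derivative_C, h.derivR, h.derivY, smul_eq_mul] at this
    linear_combination Y * this + C s * ω * hcur - C s * ω * hY' - ω * (-2 * C ρ * R + 2 * R ^ 3) * hR'

/-- The tautological point `R = t`. -/
lemma exists_X [CharZero K] (ρ : K) : ∃ ω Y, IsFormalPoint ρ ω (X : PowerSeries K) Y := by
  set c : PowerSeries K := catalanSeries.map (Nat.castRingHom K)
  have hc : (1 - 2 * X * c) ^ 2 = 1 - 4 * X := by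
    have := congrArg (PowerSeries.map (Nat.castRingHom K)) catalanSeries_sq_mul_X_add_one
    simp only [map_add, map_mul, map_pow, PowerSeries.map_X, map_one] at this
    linear_combination 4 * X * this
  set a : PowerSeries K := C (1 / 4) * (2 * C ρ * X ^ 2 - X ^ 4)
  have ha0 : constantCoeff a = 0 := by simp [a]
  have ha : HasSubst a := HasSubst.of_constantCoeff_zero' ha0
  have hq : (4 : PowerSeries K) * C (1 / 4) = 1 := by
    have : (4 : PowerSeries K) = C (4 : K) := (map_ofNat C 4).symm
    rw [this, ← map_mul]; norm_num
  set Y := 1 - 2 * a * substAlgHom ha c with hYdef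
  have hY : Y ^ 2 = 1 - 4 * a := by
    have := congrArg (substAlgHom ha) hc
    simpa only [map_sub, map_mul, map_pow, map_one, substAlgHom_X, map_ofNat] using this
  have hY0 : constantCoeff Y = 1 := by simp [hYdef, ha0]
  have hc0 : constantCoeff Y ≠ 0 := by rw [hY0]; exact one_ne_zero
  refine ⟨Y⁻¹, Y, by simp, hY0, ?_, ?_⟩
  · rw [hY]; simp only [a]; linear_combination (-2 * C ρ * X ^ 2 + X ^ 4) * hq
  · rw [derivative_X, PowerSeries.inv_mul_cancel _ hc0]

end IsFormalPoint

/-- The multiples `[α](t, y)` of the tautological formal point by `α ∈ ℤ[√-2]`. -/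
structure IsFormalMultiples {K : Type*} [Field K] (ρ : K) (φ : ℤ√(-2) →+* K)
    (R Y : ℤ√(-2) → PowerSeries K) : Prop where
  constR : ∀ α, PowerSeries.constantCoeff (R α) = 0
  constY : ∀ α, PowerSeries.constantCoeff (Y α) = 1
  curve : ∀ α, Y α ^ 2 = 1 - 2 * PowerSeries.C ρ * R α ^ 2 + R α ^ 4
  derivR : ∀ α, PowerSeries.derivative K (R α) * Y 1 = PowerSeries.C (φ α) * Y α
  R_one : R 1 = PowerSeries.X
  R_zero : R 0 = 0
  R_neg : ∀ α, R (-α) = - R α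
  Y_neg : ∀ α, Y (-α) = Y α
  R_add : ∀ α β, R (α + β) * (1 - R α ^ 2 * R β ^ 2) = R α * Y β + R β * Y α
  R_sqrtd : ∀ α, R (Zsqrtd.sqrtd * α) * Y α = PowerSeries.C (φ Zsqrtd.sqrtd) * R α
  Y_sqrtd : ∀ α, Y (Zsqrtd.sqrtd * α) * Y α ^ 2 = 1 - R α ^ 4

lemma Zsqrtd.exists_hom {K : Type*} [CommRing K] {s : K} (hs : s ^ 2 = -2) :
    ∃ φ : ℤ√(-2) →+* K, φ Zsqrtd.sqrtd = s ∧ ∀ a b : ℤ, φ ⟨a, b⟩ = a + b * s := by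
  refine ⟨Zsqrtd.lift ⟨s, by rw [← pow_two, hs]; simp⟩, ?_, ?_⟩ <;> simp [Zsqrtd.lift]

/-- Induction along the additive structure of `ℤ[√-2]`. -/
lemma Zsqrtd.add_induction {P : ℤ√(-2) → Prop} (h0 : P 0) (h1 : P 1) (hs : P Zsqrtd.sqrtd)
    (hneg : ∀ α, P α → P (-α)) (hadd : ∀ α β, P α → P β → P (α + β)) (α : ℤ√(-2)) : P α := by
  have key : ∀ β, P β → ∀ n : ℤ, P (n * β) := by
    intro β hβ n
    induction n using Int.induction_on with
    | zero => simpa using h0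
    | succ n ih => 
      have := hadd _ _ ih hβ
      convert this using 1; push_cast; ring
    | pred n ih =>
      have := hadd _ _ ih (hneg _ hβ)
      convert this using 1; push_cast; ring
  have := hadd _ _ (key 1 h1 α.re) (key _ hs α.im)
  convert this using 1
  ext <;> simp

lemma exists_isFormalMultiples {K : Type*} [Field K] [CharZero K] {ρ : K} (hρ : ρ ^ 2 = 2)
    (φ : ℤ√(-2) →+* K) : ∃ R Y, IsFormalMultiples ρ φ R Y := by
  obtain ⟨ω, Y₀, h0⟩ := IsFormalPoint.exists_X ρ
  have hs : φ Zsqrtd.sqrtd ^ 2 = -2 := by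
    rw [← map_pow, pow_two, Zsqrtd.dmuld, map_intCast]; norm_num
  have ex : ∀ α : ℤ√(-2), ∃ R Y, IsFormalPoint ρ (PowerSeries.C (φ α) * ω) R Y := by
    intro α
    induction α using Zsqrtd.add_induction with
    | h0 => exact ⟨0, 1, by simpa using IsFormalPoint.zero⟩
    | h1 => exact ⟨_, _, by simpa using h0⟩
    | hs =>
      obtain ⟨R, Y, h, -⟩ := h0.sqrt_neg_two_mul hρ hs
      exact ⟨R, Y, h⟩
    | hneg α ih =>
      obtain ⟨R, Y, h⟩ := ih
      exact ⟨-R, Y, by simpa using h.neg⟩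
    | hadd α β ih₁ ih₂ =>
      obtain ⟨R₁, Y₁, h₁⟩ := ih₁
      obtain ⟨R₂, Y₂, h₂⟩ := ih₂
      obtain ⟨R, Y, h, -⟩ := h₁.add h₂
      exact ⟨R, Y, by simpa [add_mul] using h⟩
  choose R Y h using ex
  have hRone : R 1 = PowerSeries.X := (h 1).eq_of_eq (by simpa using h0)
  have hω : ω * Y 1 = 1 := by
    have := (h 1).derivR
    rw [hRone, PowerSeries.derivative_X] at this
    simpa using this.symm
  refine ⟨R, Y, fun α => (h α).constR, fun α => (h α).constY, fun α => (h α).curve, fun α => ?_,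
    hRone, ?_, fun α => ?_, fun α => ?_, fun α β => ?_, fun α => ?_, fun α => ?_⟩
  · rw [(h α).derivR]; linear_combination PowerSeries.C (φ α) * Y α * hω
  · exact (h 0).eq_of_eq (by simpa using IsFormalPoint.zero)
  · exact (h (-α)).eq_of_eq (by simpa using (h α).neg)
  · exact (h (-α)).eq_of_eq' (by simpa using (h α).neg)
  · obtain ⟨R', Y', h', e⟩ := (h α).add (h β)
    rw [(h (α + β)).eq_of_eq (by simpa [add_mul] using h'), e]
  · obtain ⟨R', Y', h', e, -⟩ := (h α).sqrt_neg_two_mul hρ hs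
    rw [(h (Zsqrtd.sqrtd * α)).eq_of_eq (by simpa [mul_assoc] using h'), e]
  · obtain ⟨R', Y', h', -, e⟩ := (h α).sqrt_neg_two_mul hρ hs
    rw [(h (Zsqrtd.sqrtd * α)).eq_of_eq' (by simpa [mul_assoc] using h'), e]

namespace IsFormalMultiples

variable {K : Type*} [Field K] {ρ : K} {φ : ℤ√(-2) →+* K} {R Y : ℤ√(-2) → PowerSeries K}

lemma R_sub (h : IsFormalMultiples ρ φ R Y) (α β : ℤ√(-2)) :
    R (α - β) * (1 - R α ^ 2 * R β ^ 2) = R α * Y β - R β * Y α := by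
  have := h.R_add α (-β)
  rw [h.R_neg, h.Y_neg] at this
  rw [sub_eq_add_neg]
  linear_combination this

lemma sum_sq (h : IsFormalMultiples ρ φ R Y) (α β : ℤ√(-2)) :
    (R (α + β) ^ 2 + R (α - β) ^ 2) * (1 - R α ^ 2 * R β ^ 2) ^ 2 =
      2 * (R α ^ 2 * (1 - 2 * PowerSeries.C ρ * R β ^ 2 + (R β ^ 2) ^ 2) +
        R β ^ 2 * (1 - 2 * PowerSeries.C ρ * R α ^ 2 + (R α ^ 2) ^ 2)) := by
  have e1 := congrArg (· ^ 2) (h.R_add α β)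
  have e2 := congrArg (· ^ 2) (h.R_sub α β)
  beta_reduce at e1 e2
  linear_combination e1 + e2 + 2 * R α ^ 2 * h.curve β + 2 * R β ^ 2 * h.curve α

lemma prod_sq (h : IsFormalMultiples ρ φ R Y) (α β : ℤ√(-2)) :
    R (α + β) ^ 2 * R (α - β) ^ 2 * (1 - R α ^ 2 * R β ^ 2) ^ 2 = (R α ^ 2 - R β ^ 2) ^ 2 := by
  have hD : (1 - R α ^ 2 * R β ^ 2) ≠ 0 :=
    IsFormalPoint.ne_zero_of_constantCoeff (a := 1) (by simp [h.constR]) one_ne_zero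
  have e1 := h.R_add α β
  have e2 := h.R_sub α β
  have e3 : R (α + β) * R (α - β) * (1 - R α ^ 2 * R β ^ 2) = R α ^ 2 - R β ^ 2 := by
    apply mul_right_cancel₀ hD
    linear_combination e1 * (R (α - β) * (1 - R α ^ 2 * R β ^ 2)) + (R α * Y β + R β * Y α) * e2 +
      R α ^ 2 * h.curve β - R β ^ 2 * h.curve α
  rw [← e3]; ring

lemma sqrtd_sq (h : IsFormalMultiples ρ φ R Y) (α : ℤ√(-2)) :
    R (Zsqrtd.sqrtd * α) ^ 2 * (1 - 2 * PowerSeries.C ρ * R α ^ 2 + (R α ^ 2) ^ 2) =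
      - 2 * R α ^ 2 := by
  have e := congrArg (· ^ 2) (h.R_sqrtd α)
  have hs : (PowerSeries.C (φ Zsqrtd.sqrtd)) ^ 2 = (-2 : PowerSeries K) := by
    rw [← map_pow, ← map_pow, pow_two, Zsqrtd.dmuld, map_intCast, map_intCast]; norm_num
  simp only [mul_pow, hs] at e
  rw [h.curve] at e
  linear_combination e

end IsFormalMultiples

/-- Induction along parallelograms in `ℤ[√-2]`. -/
lemma Zsqrtd.parallelogram_induction {P : ℤ√(-2) → Prop} (h0 : P 0) (h1 : P 1)
    (hs : P Zsqrtd.sqrtd) (h1s : P (1 + Zsqrtd.sqrtd)) (hneg : ∀ α, P α → P (-α))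
    (hadd : ∀ α β, P α → P β → P (α - β) → P (α + β)) (α : ℤ√(-2)) : P α := by
  have key : ∀ α β, P α → P β → P (α + β) → ∀ n : ℤ, P (α + n * β) := by
    intro α β hα hβ hαβ n
    suffices P (α + n * β) ∧ P (α + (n + 1 : ℤ) * β) from this.1
    induction n using Int.induction_on with
    | zero => simpa using ⟨hα, hαβ⟩
    | succ n ih =>
      refine ⟨ih.2, ?_⟩
      have := hadd _ _ ih.2 hβ (by convert ih.1 using 1; push_cast; ring)
      convert this using 1; push_cast; ring
    | pred n ih =>
      refine ⟨?_, by convert ih.1 using 1; push_cast; ring⟩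
      have := hadd _ _ ih.1 (hneg _ hβ) (by convert ih.2 using 1; push_cast; ring)
      convert this using 1; push_cast; ring
  have h2 := key _ _ (key 0 _ h0 hs (by simpa using hs) α.im) h1
    (by have := key 1 _ h1 hs h1s α.im; convert this using 1; ring) α.re
  convert h2 using 1
  ext <;> simp

/-- The squares `x_α = R_α²` as rational functions of `x₁ = X`. -/
structure IsRationalMultiples {K : Type*} [Field K] (ρ s : K) (x : ℤ√(-2) → RatFunc K) :
    Prop where
  zero : x 0 = 0
  one : x 1 = RatFunc.X
  neg : ∀ α, x (-α) = x α
  one_sub_ne_zero : ∀ α β, 1 - x α * x β ≠ 0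
  sum : ∀ α β, (x (α + β) + x (α - β)) * (1 - x α * x β) ^ 2 =
      2 * (x α * (1 - 2 * RatFunc.C ρ * x β + x β ^ 2) +
        x β * (1 - 2 * RatFunc.C ρ * x α + x α ^ 2))
  prod : ∀ α β, x (α + β) * x (α - β) * (1 - x α * x β) ^ 2 = (x α - x β) ^ 2
  sqrtd : ∀ α, x (Zsqrtd.sqrtd * α) * (1 - 2 * RatFunc.C ρ * x α + x α ^ 2) = - 2 * x α
  one_add_sqrtd : x (1 + Zsqrtd.sqrtd) *
      (1 - 2 * RatFunc.C ρ * RatFunc.X + RatFunc.X ^ 2 + 2 * RatFunc.X ^ 2) ^ 2 =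
      RatFunc.X * (1 - RatFunc.X ^ 2 + RatFunc.C s *
        (1 - 2 * RatFunc.C ρ * RatFunc.X + RatFunc.X ^ 2)) ^ 2

namespace IsFormalMultiples

variable {K : Type*} [Field K] {ρ : K} {φ : ℤ√(-2) →+* K} {R Y : ℤ√(-2) → PowerSeries K}

lemma one_add_sqrtd_sq (h : IsFormalMultiples ρ φ R Y) :
    R (1 + Zsqrtd.sqrtd) ^ 2 * (1 - 2 * PowerSeries.C ρ * PowerSeries.X ^ 2 +
      (PowerSeries.X ^ 2) ^ 2 + 2 * (PowerSeries.X ^ 2) ^ 2) ^ 2 =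
    PowerSeries.X ^ 2 * (1 - (PowerSeries.X ^ 2) ^ 2 + PowerSeries.C (φ Zsqrtd.sqrtd) *
        (1 - 2 * PowerSeries.C ρ * PowerSeries.X ^ 2 + (PowerSeries.X ^ 2) ^ 2)) ^ 2 := by
  have e1 := h.R_add 1 Zsqrtd.sqrtd
  have e2 := h.R_sqrtd 1
  have e3 := h.Y_sqrtd 1
  have e4 := h.sqrtd_sq 1
  have e5 := h.curve 1
  rw [mul_one] at e2 e3 e4
  rw [h.R_one] at e1 e2 e3 e4 e5
  rw [e2] at e1
  have e6 : R (1 + Zsqrtd.sqrtd) * (1 - 2 * PowerSeries.C ρ * PowerSeries.X ^ 2 +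
      (PowerSeries.X ^ 2) ^ 2 + 2 * (PowerSeries.X ^ 2) ^ 2) =
    PowerSeries.X * (1 - (PowerSeries.X ^ 2) ^ 2 + PowerSeries.C (φ Zsqrtd.sqrtd) *
        (1 - 2 * PowerSeries.C ρ * PowerSeries.X ^ 2 + (PowerSeries.X ^ 2) ^ 2)) := by
    linear_combination (1 - 2 * PowerSeries.C ρ * PowerSeries.X ^ 2 + (PowerSeries.X ^ 2) ^ 2) * e1
      + R (1 + Zsqrtd.sqrtd) * PowerSeries.X ^ 2 * e4 + PowerSeries.X * e3
      - PowerSeries.X * Y Zsqrtd.sqrtd * e5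
  rw [← mul_pow, e6, mul_pow]

lemma aeval_X_sq_eq {K : Type*} [Field K] (q : Polynomial K) :
    Polynomial.aeval (PowerSeries.X ^ 2 : PowerSeries K) q =
      (Polynomial.expand K 2 q : PowerSeries K) := by
  rw [Polynomial.expand_eq_comp_X_pow, Polynomial.comp, Polynomial.aeval_def,
    ← Polynomial.coeToPowerSeries.ringHom_apply, Polynomial.hom_eval₂]
  congr 1
  · ext1; simp
  · simp

/-- Substituting `t²` for the variable embeds rational functions in the fraction field of power
series. -/
lemma exists_embedding (K : Type*) [Field K] :
    ∃ j : RatFunc K →+* FractionRing (PowerSeries K), ∀ q : Polynomial K,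
      j (algebraMap _ _ q) = algebraMap _ _ (Polynomial.aeval (PowerSeries.X ^ 2 : PowerSeries K) q) := by
  have hinj : Function.Injective ((algebraMap (PowerSeries K) (FractionRing (PowerSeries K))).comp
      (Polynomial.aeval (R := K) (PowerSeries.X ^ 2 : PowerSeries K)).toRingHom) := by
    rw [RingHom.coe_comp]
    refine (IsFractionRing.injective _ _).comp ?_
    rw [injective_iff_map_eq_zero]
    intro q hq
    change (Polynomial.aeval (PowerSeries.X ^ 2 : PowerSeries K)) q = 0 at hq
    rw [aeval_X_sq_eq, Polynomial.coe_eq_zero_iff] at hq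
    exact (Polynomial.expand_eq_zero two_pos).1 hq
  exact ⟨IsFractionRing.lift hinj, fun q => IsFractionRing.lift_algebraMap hinj q⟩

lemma exists_ratFunc (h : IsFormalMultiples ρ φ R Y) :
    ∃ x, IsRationalMultiples ρ (φ Zsqrtd.sqrtd) x ∧ ∀ α,
      R α ^ 2 * Polynomial.aeval (PowerSeries.X ^ 2 : PowerSeries K) (x α).denom =
        Polynomial.aeval (PowerSeries.X ^ 2 : PowerSeries K) (x α).num := by
  obtain ⟨j, hj⟩ := exists_embedding K
  set L := FractionRing (PowerSeries K)
  set i := algebraMap (PowerSeries K) L with hi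
  have hiinj : Function.Injective i := IsFractionRing.injective _ _
  have hX : j RatFunc.X = i (PowerSeries.X ^ 2) := by rw [← RatFunc.algebraMap_X, hj]; simp [i]
  have hC : ∀ a, j (RatFunc.C a) = i (PowerSeries.C a) := by
    intro a
    rw [← RatFunc.algebraMap_C, hj, Polynomial.aeval_C]; rfl
  have i0 : ∀ {a}, PowerSeries.constantCoeff a = 1 → i a ≠ 0 := by
    intro a ha h0
    rw [map_eq_zero_iff i hiinj] at h0
    simp [h0] at ha
  have hsum : ∀ α β, (i (R (α + β) ^ 2) + i (R (α - β) ^ 2)) * (1 - i (R α ^ 2) * i (R β ^ 2)) ^ 2 =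
      2 * (i (R α ^ 2) * (1 - 2 * i (PowerSeries.C ρ) * i (R β ^ 2) + i (R β ^ 2) ^ 2) +
        i (R β ^ 2) * (1 - 2 * i (PowerSeries.C ρ) * i (R α ^ 2) + i (R α ^ 2) ^ 2)) := by
    intro α β
    have := congrArg i (h.sum_sq α β)
    simpa only [map_mul, map_add, map_sub, map_pow, map_one, map_ofNat] using this
  have hD : ∀ α β, 1 - i (R α ^ 2) * i (R β ^ 2) ≠ 0 := by
    intro α β
    rw [← map_one i, ← map_mul, ← map_sub]
    exact i0 (by simp [h.constR])
  have ex : ∀ α, ∃ x, j x = i (R α ^ 2) := by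
    intro α
    induction α using Zsqrtd.parallelogram_induction with
    | h0 => exact ⟨0, by simp [h.R_zero]⟩
    | h1 => exact ⟨RatFunc.X, by rw [hX, h.R_one]⟩
    | hs =>
      have := congrArg i (h.sqrtd_sq 1)
      rw [h.R_one, mul_one, map_mul] at this
      refine ⟨(-2 * RatFunc.X) / (1 - 2 * RatFunc.C ρ * RatFunc.X + RatFunc.X ^ 2), ?_⟩
      rw [map_div₀, div_eq_iff]
      · simp only [map_mul, map_add, map_sub, map_pow, map_one, map_ofNat, hX, hC, map_neg] at this ⊢
        exact this.symm
      · have : j (1 - 2 * RatFunc.C ρ * RatFunc.X + RatFunc.X ^ 2) =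
          i (1 - 2 * PowerSeries.C ρ * PowerSeries.X ^ 2 + (PowerSeries.X ^ 2) ^ 2) := by
          simp only [map_mul, map_add, map_sub, map_pow, map_one, map_ofNat, hX, hC]
        rw [this]
        exact i0 (by simp)
    | h1s =>
      have := congrArg i h.one_add_sqrtd_sq
      rw [map_mul] at this
      refine ⟨(RatFunc.X * (1 - RatFunc.X ^ 2 + RatFunc.C (φ Zsqrtd.sqrtd) *
        (1 - 2 * RatFunc.C ρ * RatFunc.X + RatFunc.X ^ 2)) ^ 2) /
        (1 - 2 * RatFunc.C ρ * RatFunc.X + RatFunc.X ^ 2 + 2 * RatFunc.X ^ 2) ^ 2, ?_⟩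
      rw [map_div₀, div_eq_iff]
      · simp only [map_mul, map_add, map_sub, map_pow, map_one, map_ofNat, hX, hC] at this ⊢
        exact this.symm
      · have : j ((1 - 2 * RatFunc.C ρ * RatFunc.X + RatFunc.X ^ 2 + 2 * RatFunc.X ^ 2) ^ 2) =
          i ((1 - 2 * PowerSeries.C ρ * PowerSeries.X ^ 2 + (PowerSeries.X ^ 2) ^ 2 +
            2 * (PowerSeries.X ^ 2) ^ 2) ^ 2) := by
          simp only [map_mul, map_add, map_sub, map_pow, map_one, map_ofNat, hX, hC]
        rw [this]
        exact i0 (by simp)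
    | hneg α ih => obtain ⟨x, hx⟩ := ih; exact ⟨x, by rw [hx, h.R_neg]; ring_nf⟩
    | hadd α β ha hb hab =>
      obtain ⟨x, hx⟩ := ha
      obtain ⟨y, hy⟩ := hb
      obtain ⟨z, hz⟩ := hab
      refine ⟨2 * (x * (1 - 2 * RatFunc.C ρ * y + y ^ 2) + y * (1 - 2 * RatFunc.C ρ * x + x ^ 2)) /
        (1 - x * y) ^ 2 - z, ?_⟩
      have e : j ((1 - x * y) ^ 2) = (1 - i (R α ^ 2) * i (R β ^ 2)) ^ 2 := by simp [hx, hy]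
      rw [map_sub, map_div₀, hz, sub_eq_iff_eq_add, e, div_eq_iff (pow_ne_zero 2 (hD α β)), hsum]
      simp only [map_mul, map_add, map_sub, map_pow, map_one, map_ofNat, hx, hy, hC]
  choose x hx using ex
  have hjinj : Function.Injective j := j.injective
  refine ⟨x, ⟨?_, ?_, ?_, ?_, ?_, ?_, ?_, ?_⟩, ?_⟩
  · apply hjinj; simp [hx, h.R_zero]
  · apply hjinj; rw [hx, hX, h.R_one]
  · intro α; apply hjinj; rw [hx, hx, h.R_neg]; ring_nf
  · intro α β h0
    have := congrArg j h0
    simp only [map_sub, map_one, map_mul, hx, map_zero] at this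
    exact hD α β this
  · intro α β; apply hjinj
    simp only [map_mul, map_add, map_sub, map_pow, map_one, map_ofNat, hx, hC]
    simpa only [map_pow] using hsum α β
  · intro α β; apply hjinj
    simp only [map_mul, map_sub, map_pow, map_one, hx]
    have := congrArg i (h.prod_sq α β)
    simpa only [map_mul, map_add, map_sub, map_pow, map_one, map_ofNat] using this
  · intro α; apply hjinj
    simp only [map_mul, map_add, map_sub, map_pow, map_one, map_ofNat, hx, hC, map_neg]
    have := congrArg i (h.sqrtd_sq α)
    simpa only [map_mul, map_add, map_sub, map_pow, map_one, map_ofNat, map_neg] using this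
  · apply hjinj
    simp only [map_mul, map_add, map_sub, map_pow, map_one, map_ofNat, hx, hC, hX]
    have := congrArg i h.one_add_sqrtd_sq
    simpa only [map_mul, map_add, map_sub, map_pow, map_one, map_ofNat] using this
  · intro α
    apply hiinj
    rw [map_mul, ← hx, ← hj, ← hj, ← map_mul]
    congr 1
    conv_lhs => rw [← RatFunc.num_div_denom (x α)]
    rw [RatFunc.num_div_denom]
    have : algebraMap (Polynomial K) (RatFunc K) (x α).denom ≠ 0 := by
      simpa using (x α).denom_ne_zero
    rw [← eq_div_iff this, RatFunc.num_div_denom]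

end IsFormalMultiples

open Polynomial in
lemma Polynomial.natDegree_add_le_of_coprime_quotients {K : Type*} [Field K]
    {A₁ B₁ A₂ B₂ Q S P : K[X]} (h₁ : IsCoprime A₁ B₁) (h₂ : IsCoprime A₂ B₂) (hQ : Q ≠ 0)
    (hS : Q * (A₁ * B₂ + A₂ * B₁) = S * (B₁ * B₂)) (hP : Q * (A₁ * A₂) = P * (B₁ * B₂))
    (hB : B₁ * B₂ ≠ 0) {N : ℕ}
    (dQ : Q.natDegree ≤ N) (dS : S.natDegree ≤ N) (dP : P.natDegree ≤ N) :
    max A₁.natDegree B₁.natDegree + max A₂.natDegree B₂.natDegree ≤ N := by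
  have hdvd : B₁ * B₂ ∣ Q := by
    obtain ⟨u, v, e₁⟩ := h₁
    obtain ⟨w, z, e₂⟩ := h₂
    have d1 : B₁ * B₂ ∣ Q * (A₁ * A₂) := ⟨P, by rw [hP]; ring⟩
    have d2 : B₁ * B₂ ∣ Q * (A₁ * B₂ + A₂ * B₁) := ⟨S, by rw [hS]; ring⟩
    have d3 : B₁ * B₂ ∣ Q * (B₁ * B₂) := dvd_mul_left _ _
    have d4 : B₁ * B₂ ∣ Q * (A₁ * B₂) ^ 2 := by
      have : Q * (A₁ * B₂) ^ 2 = Q * (A₁ * B₂ + A₂ * B₁) * (A₁ * B₂) - Q * (A₁ * A₂) * (B₁ * B₂) := by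
        ring
      rw [this]
      exact dvd_sub (d2.mul_right _) (dvd_mul_left _ _)
    have d5 : B₁ * B₂ ∣ Q - Q * (A₁ * B₂) * (u * z - v * w) := by
      have : Q - Q * (A₁ * B₂) * (u * z - v * w) = Q * (A₁ * A₂) * (u * w) +
          Q * (A₁ * B₂ + A₂ * B₁) * (v * w) + Q * (B₁ * B₂) * (v * z) := by
        linear_combination -Q * (w * A₂ + z * B₂) * e₁ - Q * e₂
      rw [this]
      exact dvd_add (dvd_add (d1.mul_right _) (d2.mul_right _)) (d3.mul_right _)
    have : Q = (Q - Q * (A₁ * B₂) * (u * z - v * w)) * (1 + (A₁ * B₂) * (u * z - v * w)) +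
        Q * (A₁ * B₂) ^ 2 * (u * z - v * w) ^ 2 := by ring
    rw [this]
    exact dvd_add (d5.mul_right _) (d4.mul_right _)
  obtain ⟨E, rfl⟩ := hdvd
  have hE : E ≠ 0 := right_ne_zero_of_mul hQ
  have eS : S = E * (A₁ * B₂ + A₂ * B₁) := by
    apply mul_right_cancel₀ hB; rw [← hS]; ring
  have eP : P = E * (A₁ * A₂) := by
    apply mul_right_cancel₀ hB; rw [← hP]; ring
  set m := max A₁.natDegree B₁.natDegree with hm
  set n := max A₂.natDegree B₂.natDegree with hn
  have a1 : A₁.natDegree ≤ m := le_max_left _ _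
  have b1 : B₁.natDegree ≤ m := le_max_right _ _
  have a2 : A₂.natDegree ≤ n := le_max_left _ _
  have b2 : B₂.natDegree ≤ n := le_max_right _ _
  have key : ∀ F : K[X], (E * F).natDegree ≤ N → F.coeff (m + n) ≠ 0 → m + n ≤ N := by
    intro F hF hc
    have hF0 : F ≠ 0 := by rintro rfl; simp at hc
    rw [natDegree_mul hE hF0] at hF
    have := le_natDegree_of_ne_zero hc
    omega
  have nz1 : A₁.coeff m ≠ 0 ∨ B₁.coeff m ≠ 0 := by
    have hb : B₁ ≠ 0 := left_ne_zero_of_mul hB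
    rcases le_total A₁.natDegree B₁.natDegree with h | h
    · right; rw [hm, max_eq_right h]; simpa using hb
    · by_cases ha : A₁ = 0
      · right; subst ha; rw [hm]; simpa using hb
      · left; rw [hm, max_eq_left h]; simpa using ha
  have nz2 : A₂.coeff n ≠ 0 ∨ B₂.coeff n ≠ 0 := by
    have hb : B₂ ≠ 0 := right_ne_zero_of_mul hB
    rcases le_total A₂.natDegree B₂.natDegree with h | h
    · right; rw [hn, max_eq_right h]; simpa using hb
    · by_cases ha : A₂ = 0
      · right; subst ha; rw [hn]; simpa using hb
      · left; rw [hn, max_eq_left h]; simpa using ha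
  have cAA := coeff_mul_add_eq_of_natDegree_le a1 a2
  have cBB := coeff_mul_add_eq_of_natDegree_le b1 b2
  have cAB := coeff_mul_add_eq_of_natDegree_le a1 b2
  have cBA := coeff_mul_add_eq_of_natDegree_le b1 a2
  by_cases hAA : A₁.coeff m * A₂.coeff n = 0
  · by_cases hBB : B₁.coeff m * B₂.coeff n = 0
    · refine key (A₁ * B₂ + A₂ * B₁) (by rwa [← eS]) ?_
      rw [coeff_add, cAB, mul_comm A₂ B₁, cBA]
      rcases mul_eq_zero.1 hAA with h | h
      · have hb := nz1.resolve_left (by simpa using h)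
        have hb2 := (mul_eq_zero.1 hBB).resolve_left hb
        have ha2 := nz2.resolve_right (by simpa using hb2)
        rw [h, zero_mul, zero_add]; exact mul_ne_zero hb ha2
      · have hb := nz2.resolve_left (by simpa using h)
        have hb2 := (mul_eq_zero.1 hBB).resolve_right hb
        have ha2 := nz1.resolve_right (by simpa using hb2)
        rw [h, mul_zero, add_zero]; exact mul_ne_zero ha2 hb
    · exact key (B₁ * B₂) (by rwa [mul_comm]) (by rw [cBB]; exact hBB)
  · exact key (A₁ * A₂) (by rwa [← eP]) (by rw [cAA]; exact hAA)

lemma Polynomial.natDegree_sub_le_of_degree_le {K : Type*} [Ring K] {p q : Polynomial K} {n : ℕ}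
    (hp : p.natDegree ≤ n) (hq : q.natDegree ≤ n) : (p - q).natDegree ≤ n :=
  (natDegree_sub_le_of_le hp hq).trans (max_self n).le

namespace RatFunc

variable {K : Type*} [Field K]

/-- The degree of a rational function as a self-map of the projective line. -/
noncomputable def height (x : RatFunc K) : ℕ := max x.num.natDegree x.denom.natDegree

open Polynomial

lemma exists_coprime_smul {x : RatFunc K} {A B : K[X]} (h : IsCoprime A B)
    (hx : x * algebraMap _ _ B = algebraMap _ _ A) :
    ∃ c : K, c ≠ 0 ∧ A = Polynomial.C c * x.num ∧ B = Polynomial.C c * x.denom := by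
  have e : x.num * B = x.denom * A := by
    apply RatFunc.algebraMap_injective K
    rw [map_mul, map_mul, ← hx]
    have hd : algebraMap K[X] (RatFunc K) x.denom ≠ 0 := by simpa using x.denom_ne_zero
    conv_rhs => rw [← RatFunc.num_div_denom x]
    rw [RatFunc.num_div_denom]
    conv_rhs => rw [← mul_assoc, ← RatFunc.num_div_denom x]
    rw [RatFunc.num_div_denom]
    congr 1
    have := RatFunc.num_div_denom x
    rw [div_eq_iff hd] at this
    rw [this]; ring
  have d1 : B ∣ x.denom := h.symm.dvd_of_dvd_mul_right ⟨x.num, by rw [← e]; ring⟩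
  have d2 : x.denom ∣ B := x.isCoprime_num_denom.symm.dvd_of_dvd_mul_left ⟨A, e⟩
  obtain ⟨u, hu⟩ := associated_of_dvd_dvd d2 d1
  obtain ⟨c, hc, hcu⟩ := Polynomial.isUnit_iff.1 u.isUnit
  refine ⟨c, hc.ne_zero, ?_, ?_⟩
  · apply mul_left_cancel₀ x.denom_ne_zero
    rw [← e, ← hu, ← hcu]; ring
  · rw [← hu, ← hcu]; ring

lemma height_eq {x : RatFunc K} {A B : K[X]} (h : IsCoprime A B)
    (hx : x * algebraMap _ _ B = algebraMap _ _ A) :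
    x.height = max A.natDegree B.natDegree := by
  obtain ⟨c, hc, hA, hB'⟩ := exists_coprime_smul h hx
  rw [hA, hB', natDegree_C_mul hc, natDegree_C_mul hc, height]

lemma mul_denom (x : RatFunc K) :
    x * algebraMap K[X] (RatFunc K) x.denom = algebraMap K[X] (RatFunc K) x.num := by
  have hd : algebraMap K[X] (RatFunc K) x.denom ≠ 0 := by simpa using x.denom_ne_zero
  exact ((div_eq_iff hd).1 x.num_div_denom).symm

lemma coeff_height_ne_zero (x : RatFunc K) :
    x.num.coeff x.height ≠ 0 ∨ x.denom.coeff x.height ≠ 0 := by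
  have hb := x.denom_ne_zero
  rcases le_total x.num.natDegree x.denom.natDegree with h | h
  · right; rw [height, max_eq_right h]; simpa using hb
  · by_cases ha : x.num = 0
    · right; rw [height, ha]; simpa using hb
    · left; rw [height, max_eq_left h]; simpa using ha

end RatFunc

namespace IsRationalMultiples

open Polynomial

variable {K : Type*} [Field K] {ρ s : K} {x : ℤ√(-2) → RatFunc K}

lemma height_parallelogram_le (h : IsRationalMultiples ρ s x) (α β : ℤ√(-2)) :
    (x (α + β)).height + (x (α - β)).height ≤ 2 * (x α).height + 2 * (x β).height := by
  have e1 := (x α).mul_denom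
  have e2 := (x β).mul_denom
  have e3 := (x (α + β)).mul_denom
  have e4 := (x (α - β)).mul_denom
  have hsum := h.sum α β
  have hprod := h.prod α β
  have hne := h.one_sub_ne_zero α β
  have d1 := (x α).denom_ne_zero
  have d2 := (x β).denom_ne_zero
  have a1 : (x α).num.natDegree ≤ (x α).height := le_max_left _ _
  have b1 : (x α).denom.natDegree ≤ (x α).height := le_max_right _ _
  have a2 : (x β).num.natDegree ≤ (x β).height := le_max_left _ _
  have b2 : (x β).denom.natDegree ≤ (x β).height := le_max_right _ _
  have hinj := RatFunc.algebraMap_injective K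
  set A := (x α).num
  set B := (x α).denom
  set A' := (x β).num
  set B' := (x β).denom
  have db1 : algebraMap K[X] (RatFunc K) B ≠ 0 := by simpa using d1
  have db2 : algebraMap K[X] (RatFunc K) B' ≠ 0 := by simpa using d2
  refine natDegree_add_le_of_coprime_quotients (x (α + β)).isCoprime_num_denom
    (x (α - β)).isCoprime_num_denom (Q := (B * B' - A * A') ^ 2)
    (S := 2 * (A * B * (B' * B' - C (2 * ρ) * (A' * B') + A' * A') +
      A' * B' * (B * B - C (2 * ρ) * (A * B) + A * A))) (P := (A * B' - A' * B) ^ 2) ?_ ?_ ?_ ?_ ?_ ?_ ?_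
  · intro h0
    apply hne
    have := pow_eq_zero_iff (two_ne_zero) |>.1 h0
    have := congrArg (algebraMap K[X] (RatFunc K)) this
    simp only [map_sub, map_mul, ← e1, ← e2, map_zero] at this
    apply mul_right_cancel₀ (mul_ne_zero db1 db2)
    linear_combination this
  · apply hinj
    simp only [map_sub, map_mul, map_add, map_pow, ← e1, ← e2, ← e3, ← e4, map_ofNat,
      RatFunc.algebraMap_C]
    generalize algebraMap K[X] (RatFunc K) B = b at *
    generalize algebraMap K[X] (RatFunc K) B' = b' at *
    linear_combination b ^ 2 * b' ^ 2 * algebraMap K[X] (RatFunc K) (x (α + β)).denom *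
      algebraMap K[X] (RatFunc K) (x (α - β)).denom * hsum
  · apply hinj
    simp only [map_sub, map_mul, map_pow, ← e1, ← e2, ← e3, ← e4]
    generalize algebraMap K[X] (RatFunc K) B = b at *
    generalize algebraMap K[X] (RatFunc K) B' = b' at *
    linear_combination b ^ 2 * b' ^ 2 * algebraMap K[X] (RatFunc K) (x (α + β)).denom *
      algebraMap K[X] (RatFunc K) (x (α - β)).denom * hprod
  · exact mul_ne_zero (x (α + β)).denom_ne_zero (x (α - β)).denom_ne_zero
  · have : (B * B' - A * A').natDegree ≤ (x α).height + (x β).height :=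
      natDegree_sub_le_of_degree_le (natDegree_mul_le_of_le b1 b2) (natDegree_mul_le_of_le a1 a2)
    exact (natDegree_pow_le_of_le 2 this).trans (by omega)
  · have q1 : ∀ U V : K[X], ∀ n, U.natDegree ≤ n → V.natDegree ≤ n → 
        (V * V - C (2 * ρ) * (U * V) + U * U).natDegree ≤ n + n := fun U V n hU hV =>
      natDegree_add_le_of_degree_le (natDegree_sub_le_of_degree_le (natDegree_mul_le_of_le hV hV)
        ((natDegree_C_mul_le _ _).trans (natDegree_mul_le_of_le hU hV))) (natDegree_mul_le_of_le hU hU)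
    have e : (2 : K[X]) = C 2 := (map_ofNat C 2).symm
    rw [e]
    refine (natDegree_C_mul_le _ _).trans (natDegree_add_le_of_degree_le ?_ ?_)
    · exact (natDegree_mul_le_of_le (natDegree_mul_le_of_le a1 b1) (q1 _ _ _ a2 b2)).trans (by omega)
    · exact (natDegree_mul_le_of_le (natDegree_mul_le_of_le a2 b2) (q1 _ _ _ a1 b1)).trans (by omega)
  · have : (A * B' - A' * B).natDegree ≤ (x α).height + (x β).height :=
      natDegree_sub_le_of_degree_le (natDegree_mul_le_of_le a1 b2)
        ((natDegree_mul_le_of_le a2 b1).trans (add_comm _ _).le)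
    exact (natDegree_pow_le_of_le 2 this).trans (by omega)

lemma height_sqrtd_mul [CharZero K] (h : IsRationalMultiples ρ s x) (α : ℤ√(-2)) :
    (x (Zsqrtd.sqrtd * α)).height = 2 * (x α).height := by
  have e1 := (x α).mul_denom
  have hq := h.sqrtd α
  have a1 : (x α).num.natDegree ≤ (x α).height := le_max_left _ _
  have b1 : (x α).denom.natDegree ≤ (x α).height := le_max_right _ _
  have hcop := (x α).isCoprime_num_denom
  have hnz := (x α).coeff_height_ne_zero
  set A := (x α).num
  set B := (x α).denom
  set n := (x α).height
  have hc : IsCoprime (C (-2) * (A * B)) (B * B - C (2 * ρ) * (A * B) + A * A) := by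
    refine (isCoprime_mul_unit_left_left (isUnit_C.2 (by simp)) _ _).2 (IsCoprime.mul_left ?_ ?_)
    · have : IsCoprime A (B * B) := hcop.mul_right hcop
      have e : B * B - C (2 * ρ) * (A * B) + A * A = B * B + A * (- C (2 * ρ) * B + A) := by ring
      rw [e]
      exact this.add_mul_left_right _
    · have : IsCoprime B (A * A) := hcop.symm.mul_right hcop.symm
      have e : B * B - C (2 * ρ) * (A * B) + A * A = A * A + B * (- C (2 * ρ) * A + B) := by ring
      rw [e]
      exact this.add_mul_left_right _
  have cAB := coeff_mul_add_eq_of_natDegree_le a1 b1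
  have cAA := coeff_mul_add_eq_of_natDegree_le a1 a1
  have cBB := coeff_mul_add_eq_of_natDegree_le b1 b1
  rw [RatFunc.height_eq hc ?_]
  · apply le_antisymm
    · refine max_le ?_ ?_
      · exact (natDegree_C_mul_le _ _).trans ((natDegree_mul_le_of_le a1 b1).trans (by omega))
      · exact natDegree_add_le_of_degree_le (natDegree_sub_le_of_degree_le ((natDegree_mul_le_of_le b1 b1).trans (by omega))
          ((natDegree_C_mul_le _ _).trans ((natDegree_mul_le_of_le a1 b1).trans (by omega))))
          ((natDegree_mul_le_of_le a1 a1).trans (by omega))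
    · rw [two_mul]
      by_cases h0 : A.coeff n * B.coeff n = 0
      · refine le_max_of_le_right (le_natDegree_of_ne_zero ?_)
        rw [coeff_add, coeff_sub, coeff_C_mul, cAB, cAA, cBB, h0]
        rcases mul_eq_zero.1 h0 with h1 | h1
        · have := hnz.resolve_left (by simpa using h1)
          simpa [h1] using this
        · have := hnz.resolve_right (by simpa using h1)
          simpa [h1] using this
      · refine le_max_of_le_left (le_natDegree_of_ne_zero ?_)
        rw [coeff_C_mul, cAB]
        exact mul_ne_zero (by simp) h0
  · simp only [map_sub, map_mul, map_add, ← e1, RatFunc.algebraMap_C, map_ofNat, map_neg]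
    linear_combination (algebraMap K[X] (RatFunc K) B) ^ 2 * hq

lemma height_parallelogram [CharZero K] (h : IsRationalMultiples ρ s x) (α β : ℤ√(-2)) :
    (x (α + β)).height + (x (α - β)).height = 2 * (x α).height + 2 * (x β).height := by
  have h2 : ∀ γ, (x (2 * γ)).height = 4 * (x γ).height := by
    intro γ
    have e : x (2 * γ) = x (Zsqrtd.sqrtd * (Zsqrtd.sqrtd * γ)) := by
      rw [← h.neg, ← mul_assoc, Zsqrtd.dmuld]; congr 1; push_cast; ring
    rw [e, h.height_sqrtd_mul, h.height_sqrtd_mul]; ring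
  apply le_antisymm (h.height_parallelogram_le α β)
  have := h.height_parallelogram_le (α + β) (α - β)
  rw [show α + β + (α - β) = 2 * α by ring, show α + β - (α - β) = 2 * β by ring, h2, h2] at this
  omega

lemma height_eq_norm [CharZero K] (h : IsRationalMultiples ρ s x) (α : ℤ√(-2)) :
    ((x α).height : ℤ) = α.norm := by
  have hs0 := h.height_sqrtd_mul 1
  have h10 : (x 1).height = 1 := by rw [h.one]; simp [RatFunc.height]
  rw [mul_one, h10] at hs0
  induction α using Zsqrtd.parallelogram_induction with
  | h0 => rw [h.zero]; simp [RatFunc.height]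
  | h1 => rw [h10]; simp
  | hs => rw [hs0]; simp [Zsqrtd.norm_def]
  | h1s =>
    have e1 := h.height_parallelogram Zsqrtd.sqrtd 1
    have e2 := h.height_parallelogram (Zsqrtd.sqrtd - 1) 1
    have e3 := h.height_sqrtd_mul (1 + Zsqrtd.sqrtd)
    rw [mul_add, Zsqrtd.dmuld, mul_one] at e3
    rw [sub_add_cancel] at e2
    have e4 : (Zsqrtd.sqrtd + ((-2 : ℤ) : ℤ√(-2))) = Zsqrtd.sqrtd - 1 - 1 := by push_cast; ring
    rw [e4] at e3
    rw [add_comm] at e1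
    have : (x (1 + Zsqrtd.sqrtd)).height = 3 := by
      rw [add_comm Zsqrtd.sqrtd] at e1
      omega
    rw [this]; simp [Zsqrtd.norm_def]
  | hneg α ih => rw [h.neg, ih]; simp [Zsqrtd.norm_def]
  | hadd α β ha hb hab =>
    have e1 := h.height_parallelogram α β
    have : ((x (α + β)).height : ℤ) = 2 * (x α).height + 2 * (x β).height - (x (α - β)).height := by
      omega
    rw [this, ha, hb, hab]
    simp [Zsqrtd.norm_def]; ring

end IsRationalMultiples

namespace RatFunc

variable {K : Type*} [Field K]

open Polynomial in
lemma exists_inversion (K : Type*) [Field K] :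
    ∃ ι : RatFunc K →+* RatFunc K, ι RatFunc.X = RatFunc.X⁻¹ ∧ (∀ a, ι (RatFunc.C a) = RatFunc.C a) ∧
      ∀ (q : K[X]) (N : ℕ), q.natDegree ≤ N →
        ι (algebraMap _ _ q) * RatFunc.X ^ N = algebraMap _ _ (q.reflect N) := by
  let _ : Invertible (RatFunc.X : RatFunc K) := invertibleOfNonzero RatFunc.X_ne_zero
  let _ : Invertible (RatFunc.X⁻¹ : RatFunc K) := invertibleOfNonzero (inv_ne_zero RatFunc.X_ne_zero)
  have e : ∀ q : K[X], algebraMap K[X] (RatFunc K) q = eval₂ RatFunc.C RatFunc.X q := by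
    intro q
    have : algebraMap K[X] (RatFunc K) = eval₂RingHom RatFunc.C RatFunc.X :=
      Polynomial.ringHom_ext (by simp) (by simp)
    rw [this, coe_eval₂RingHom]
  have key : ∀ (q : K[X]) (N : ℕ), q.natDegree ≤ N →
      eval₂ RatFunc.C (RatFunc.X⁻¹) q * RatFunc.X ^ N = algebraMap K[X] (RatFunc K) (q.reflect N) := by
    intro q N hN
    have := eval₂_reflect_mul_pow RatFunc.C (RatFunc.X⁻¹ : RatFunc K) N q hN
    rw [invOf_eq_inv, inv_inv] at this
    rw [e, ← this, mul_assoc, ← mul_pow, inv_mul_cancel₀ RatFunc.X_ne_zero, one_pow, mul_one]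
  have hinj : Function.Injective (eval₂RingHom (RatFunc.C : K →+* RatFunc K) (RatFunc.X⁻¹)) := by
    rw [injective_iff_map_eq_zero]
    intro q hq
    have := key q _ le_rfl
    rw [coe_eval₂RingHom] at hq
    rw [hq, zero_mul, eq_comm] at this
    simpa using this
  have h : ∀ q, IsFractionRing.lift hinj (algebraMap K[X] (RatFunc K) q) =
    eval₂ RatFunc.C (RatFunc.X⁻¹) q := fun q => IsFractionRing.lift_algebraMap hinj q
  refine ⟨IsFractionRing.lift hinj, ?_, ?_, ?_⟩
  · have := h Polynomial.X
    rwa [eval₂_X, RatFunc.algebraMap_X] at this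
  · intro a
    have := h (Polynomial.C a)
    rwa [eval₂_C, RatFunc.algebraMap_C] at this
  · intro q N hN
    rw [h, key q N hN]

end RatFunc

namespace IsRationalMultiples

variable {K : Type*} [Field K] {ρ s : K} {x : ℤ√(-2) → RatFunc K} {ι : RatFunc K →+* RatFunc K}

lemma inversion_apply [CharZero K] (h : IsRationalMultiples ρ s x) (hρ : ρ ^ 2 = 2)
    (hs : s ^ 2 = -2) (hX : ι RatFunc.X = RatFunc.X⁻¹)
    (hC : ∀ a, ι (RatFunc.C a) = RatFunc.C a) (α : ℤ√(-2)) :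
    (Even α.re → ι (x α) = x α) ∧ (Odd α.re → ι (x α) * x α = 1) := by
  have hX0 : (RatFunc.X : RatFunc K) ≠ 0 := RatFunc.X_ne_zero
  have hρ' : (RatFunc.C ρ : RatFunc K) ^ 2 = 2 := by rw [← map_pow, hρ, map_ofNat]
  have hs' : (RatFunc.C s : RatFunc K) ^ 2 = -2 := by rw [← map_pow, hs, map_neg, map_ofNat]
  induction α using Zsqrtd.parallelogram_induction with
  | h0 => simp [h.zero]
  | h1 => simp [h.one, hX, hX0]
  | hs =>
    refine ⟨fun _ => ?_, fun h => by simp at h⟩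
    have e := h.sqrtd 1
    rw [mul_one, h.one] at e
    have e' := congrArg ι e
    simp only [map_mul, map_add, map_sub, map_pow, map_one, map_ofNat, map_neg, hX, hC] at e'
    have e'' : ι (x Zsqrtd.sqrtd) * (1 - 2 * RatFunc.C ρ * RatFunc.X + RatFunc.X ^ 2) =
        -2 * RatFunc.X := by
      field_simp at e'
      linear_combination e'
    have hne : (1 - 2 * RatFunc.C ρ * RatFunc.X + RatFunc.X ^ 2 : RatFunc K) ≠ 0 := by
      intro h0
      rw [h0, mul_zero] at e
      have h2 : (-2 : RatFunc K) ≠ 0 := by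
        have : (-2 : RatFunc K) = RatFunc.C (-2 : K) := by rw [map_neg, map_ofNat]
        rw [this]; simp
      exact mul_ne_zero h2 hX0 e.symm
    exact mul_right_cancel₀ hne (e''.trans e.symm)
  | h1s =>
    refine ⟨fun h => by simp at h, fun _ => ?_⟩
    have e := h.one_add_sqrtd
    have e' := congrArg ι e
    simp only [map_mul, map_add, map_sub, map_pow, map_one, map_ofNat, hX, hC] at e'
    set z := x (1 + Zsqrtd.sqrtd)
    have h3 : (1 - 2 * RatFunc.C ρ * RatFunc.X + 3 * RatFunc.X ^ 2 : RatFunc K) ≠ 0 := by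
      have : (1 - 2 * RatFunc.C ρ * RatFunc.X + 3 * RatFunc.X ^ 2 : RatFunc K) =
          algebraMap (Polynomial K) (RatFunc K)
            (1 - 2 * Polynomial.C ρ * Polynomial.X + 3 * Polynomial.X ^ 2) := by
        simp only [map_sub, map_add, map_mul, map_pow, map_one, map_ofNat, RatFunc.algebraMap_C,
          RatFunc.algebraMap_X]
      rw [this, map_ne_zero_iff _ (RatFunc.algebraMap_injective K)]
      intro h0
      have := congrArg (Polynomial.eval 0) h0
      simp at this
    have h4 : (3 - 2 * RatFunc.C ρ * RatFunc.X + RatFunc.X ^ 2 : RatFunc K) ≠ 0 := by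
      have : (3 - 2 * RatFunc.C ρ * RatFunc.X + RatFunc.X ^ 2 : RatFunc K) =
          algebraMap (Polynomial K) (RatFunc K)
            (3 - 2 * Polynomial.C ρ * Polynomial.X + Polynomial.X ^ 2) := by
        simp only [map_sub, map_add, map_mul, map_pow, map_ofNat, RatFunc.algebraMap_C,
          RatFunc.algebraMap_X]
      rw [this, map_ne_zero_iff _ (RatFunc.algebraMap_injective K)]
      intro h0
      have := congrArg (Polynomial.eval 0) h0
      simp at this
    generalize ι z = w at *
    generalize RatFunc.C ρ = a at *
    generalize RatFunc.C s = b at *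
    generalize (RatFunc.X : RatFunc K) = X at *
    apply mul_right_cancel₀ (mul_ne_zero (mul_ne_zero (pow_ne_zero 2 h3) (pow_ne_zero 2 h4)) hX0)
    have e2 : w * (3 - 2 * a * X + X ^ 2) ^ 2 * X = (X ^ 2 - 1 + b * (1 - 2 * a * X + X ^ 2)) ^ 2 := by
      field_simp at e'
      linear_combination e'
    have e3 : (1 - X ^ 2 + b * (1 - 2 * a * X + X ^ 2)) * (X ^ 2 - 1 + b * (1 - 2 * a * X + X ^ 2)) =
       - ((1 - 2 * a * X + 3 * X ^ 2) * (3 - 2 * a * X + X ^ 2)) := by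
      linear_combination (1 - 2 * a * X + X ^ 2) ^ 2 * hs' - 4 * X ^ 2 * hρ'
    calc w * z * ((1 - 2 * a * X + 3 * X ^ 2) ^ 2 * (3 - 2 * a * X + X ^ 2) ^ 2 * X)
        = (z * (1 - 2 * a * X + X ^ 2 + 2 * X ^ 2) ^ 2) * (w * (3 - 2 * a * X + X ^ 2) ^ 2 * X) := by
          ring
      _ = X * ((1 - X ^ 2 + b * (1 - 2 * a * X + X ^ 2)) *
          (X ^ 2 - 1 + b * (1 - 2 * a * X + X ^ 2))) ^ 2 := by rw [e, e2]; ring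
      _ = _ := by rw [e3]; ring
  | hneg α ih =>
    rw [h.neg]
    simpa using ih
  | hadd α β ha hb hab =>
    have e := h.sum α β
    have e' := congrArg ι e
    have ep := h.prod α β
    have hne := h.one_sub_ne_zero α β
    simp only [map_mul, map_add, map_sub, map_pow, map_one, map_ofNat, hC] at e'
    rw [Zsqrtd.re_add]
    rw [Zsqrtd.re_sub] at hab
    generalize x (α + β) = z at *
    generalize x (α - β) = z' at *
    generalize x α = y at *
    generalize x β = y' at *
    generalize RatFunc.C ρ = a at *
    have inv : ∀ {w : RatFunc K}, ι w * w = 1 → w ≠ 0 ∧ ι w = w⁻¹ := fun {w} hw =>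
      ⟨right_ne_zero_of_mul (hw.trans_ne one_ne_zero), eq_inv_of_mul_eq_one_left hw⟩
    rcases Int.even_or_odd α.re with pa | pa <;> rcases Int.even_or_odd β.re with pb | pb
    · refine ⟨fun _ => ?_, fun ho => absurd (pa.add pb) (Int.not_even_iff_odd.2 ho)⟩
      rw [ha.1 pa, hb.1 pb, hab.1 (pa.sub pb), ← e] at e'
      simpa using mul_right_cancel₀ (pow_ne_zero 2 hne) e'
    · refine ⟨fun ho => absurd ho (Int.not_even_iff_odd.2 (pa.add_odd pb)), fun _ => ?_⟩
      obtain ⟨hz', iz'⟩ := inv (hab.2 (pa.sub_odd pb))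
      obtain ⟨hy', iy'⟩ := inv (hb.2 pb)
      rw [ha.1 pa, iy', iz'] at e'
      field_simp at e'
      apply mul_right_cancel₀ (mul_ne_zero (mul_ne_zero hz' hz') (pow_ne_zero 2 hne))
      linear_combination e' + (ι z * z' + 1) * ep - z' * e
    · refine ⟨fun ho => absurd ho (Int.not_even_iff_odd.2 (pa.add_even pb)), fun _ => ?_⟩
      obtain ⟨hz', iz'⟩ := inv (hab.2 (pa.sub_even pb))
      obtain ⟨hy, iy⟩ := inv (ha.2 pa)
      rw [hb.1 pb, iy, iz'] at e'
      field_simp at e'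
      apply mul_right_cancel₀ (mul_ne_zero (mul_ne_zero hz' hz') (pow_ne_zero 2 hne))
      linear_combination e' + (ι z * z' + 1) * ep - z' * e
    · refine ⟨fun _ => ?_, fun ho => absurd (pa.add_odd pb) (Int.not_even_iff_odd.2 ho)⟩
      obtain ⟨hy, iy⟩ := inv (ha.2 pa)
      obtain ⟨hy', iy'⟩ := inv (hb.2 pb)
      rw [iy, iy', hab.1 (pa.sub_odd pb)] at e'
      field_simp at e'
      have e2 : (ι z + z') * (1 - y * y') ^ 2 = (z + z') * (1 - y * y') ^ 2 := by
        linear_combination e' - e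
      simpa using mul_right_cancel₀ (pow_ne_zero 2 hne) e2

end IsRationalMultiples

namespace Polynomial

lemma natDegree_reflect_le_of_le {R : Type*} [Semiring R] {N : ℕ} {q : R[X]}
    (h : q.natDegree ≤ N) : (q.reflect N).natDegree ≤ N :=
  natDegree_reflect_le.trans (max_eq_left h).le

lemma reflect_X_mul {R : Type*} [Semiring R] {N : ℕ} {q : R[X]} (h : q.natDegree ≤ N) :
    (X * q).reflect (N + 1) = q.reflect N := by
  have := reflect_mul X q (F := 1) natDegree_X_le h
  rw [add_comm, this]
  have e : (X : R[X]).reflect 1 = 1 := by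
    simp
  rw [e, one_mul]

lemma reflect_expand_two {R : Type*} [CommSemiring R] {n : ℕ} {q : R[X]} :
    (expand R 2 q).reflect (2 * n) = expand R 2 (q.reflect n) := by
  ext i
  rw [coeff_reflect, coeff_expand two_pos, coeff_expand two_pos, coeff_reflect]
  rcases le_or_gt i (2 * n) with hi | hi
  · rw [revAt_le hi]
    by_cases h2 : 2 ∣ i
    · rw [if_pos h2, if_pos (by lia), revAt_le (by lia)]
      congr 1; lia
    · rw [if_neg h2, if_neg (by lia)]
  · rw [revAt_eq_self_of_lt hi]
    by_cases h2 : 2 ∣ i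
    · rw [if_pos h2, if_pos h2, revAt_eq_self_of_lt (by lia)]
    · rw [if_neg h2, if_neg h2]

lemma eq_C_mul_of_cross_mul_eq {K : Type*} [Field K] {A B P Q : K[X]} {N : ℕ}
    (hAB : IsCoprime A B) (hB : B ≠ 0) (hP : P.natDegree ≤ N) (hQ : Q.natDegree ≤ N)
    (hN : A.coeff N ≠ 0 ∨ B.coeff N ≠ 0) (h : P * B = A * Q) :
    ∃ κ : K, P = C κ * A ∧ Q = C κ * B := by
  obtain ⟨q, rfl⟩ : B ∣ Q := hAB.symm.dvd_of_dvd_mul_left ⟨P, by rw [← h, mul_comm]⟩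
  have e : P = A * q := mul_right_cancel₀ hB (by rw [h]; ring)
  suffices q.natDegree = 0 by
    obtain ⟨κ, rfl⟩ := natDegree_eq_zero.1 this
    exact ⟨κ, by rw [e, mul_comm], mul_comm _ _⟩
  by_cases hq : q = 0
  · simp [hq]
  · have key : ∀ F : K[X], F.coeff N ≠ 0 → (F * q).natDegree ≤ N → q.natDegree = 0 := by
      intro F hF h
      have := le_natDegree_of_ne_zero hF
      rw [natDegree_mul (by rintro rfl; simp at hF) hq] at h
      lia
    rcases hN with hN | hN
    · exact key A hN (e ▸ hP)
    · exact key B hN hQ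

end Polynomial

open Polynomial in
lemma IsRationalMultiples.reflect_num_denom {K : Type*} [Field K] [CharZero K] {ρ s : K}
    {x : ℤ√(-2) → RatFunc K} (h : IsRationalMultiples ρ s x) (hρ : ρ ^ 2 = 2) (hs : s ^ 2 = -2)
    (α : ℤ√(-2)) : ∃ κ : K, κ ^ 2 = 1 ∧
      (Even α.re → (x α).num.reflect (x α).height = C κ * (x α).num ∧
        (x α).denom.reflect (x α).height = C κ * (x α).denom) ∧
      (Odd α.re → (x α).num.reflect (x α).height = C κ * (x α).denom ∧
        (x α).denom.reflect (x α).height = C κ * (x α).num) := by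
  obtain ⟨ι, hX, hC, hι⟩ := RatFunc.exists_inversion K
  have inv := h.inversion_apply hρ hs hX hC α
  generalize x α = y at *
  have hA : y.num.natDegree ≤ y.height := le_max_left _ _
  have hB : y.denom.natDegree ≤ y.height := le_max_right _ _
  have hb := y.denom_ne_zero
  have hc := y.isCoprime_num_denom
  have hN := y.coeff_height_ne_zero
  have e1 := hι _ _ hA
  have e2 := hι _ _ hB
  have e0 := y.mul_denom
  have e3 : ι y * algebraMap _ _ (y.denom.reflect y.height) =
      algebraMap _ _ (y.num.reflect y.height) := by
    rw [← e1, ← e2, ← mul_assoc, ← map_mul, e0]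
  have hA' := natDegree_reflect_le_of_le hA
  have hB' := natDegree_reflect_le_of_le hB
  generalize y.height = N at *
  have sq_one : ∀ {κ : K}, y.denom = C κ * (C κ * y.denom) → κ ^ 2 = 1 := by
    intro κ h
    have : C (κ ^ 2) * y.denom = C 1 * y.denom := by
      rw [map_one, one_mul, map_pow, pow_two, mul_assoc, ← h]
    exact C_injective (mul_right_cancel₀ hb this)
  rcases Int.even_or_odd α.re with hα | hα
  · have := inv.1 hα
    obtain ⟨κ, h1, h2⟩ := eq_C_mul_of_cross_mul_eq hc hb hA' hB' hN (by
      apply RatFunc.algebraMap_injective K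
      rw [map_mul, map_mul, ← e3, ← e0, this]; ring)
    refine ⟨κ, sq_one ?_, fun _ => ⟨h1, h2⟩, fun ho => absurd hα (Int.not_even_iff_odd.2 ho)⟩
    have := congrArg (reflect N) h2
    rwa [reflect_reflect, reflect_C_mul, h2] at this
  · have := inv.2 hα
    obtain ⟨κ, h1, h2⟩ := eq_C_mul_of_cross_mul_eq hc hb hB' hA' hN (by
      apply RatFunc.algebraMap_injective K
      rw [map_mul, map_mul, ← e3, ← e0, mul_mul_mul_comm, mul_comm y, this, one_mul, mul_comm])
    refine ⟨κ, sq_one ?_, fun he => absurd hα (Int.not_odd_iff_even.2 he), fun _ => ⟨h2, h1⟩⟩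
    have := congrArg (reflect N) h2
    rw [reflect_reflect, reflect_C_mul] at this
    have h3 := congrArg (reflect N) h1
    rw [reflect_reflect, reflect_C_mul, h2] at h3
    exact h3

namespace IsFormalMultiples

variable {K : Type*} [Field K] {ρ : K} {φ : ℤ√(-2) →+* K} {R Y : ℤ√(-2) → PowerSeries K}

open Polynomial

lemma prod_R (h : IsFormalMultiples ρ φ R Y) (α β : ℤ√(-2)) :
    R (α + β) * R (α - β) * (1 - R α ^ 2 * R β ^ 2) = R α ^ 2 - R β ^ 2 := by
  have hD : (1 - R α ^ 2 * R β ^ 2) ≠ 0 :=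
    IsFormalPoint.ne_zero_of_constantCoeff (a := 1) (by simp [h.constR]) one_ne_zero
  have e1 := h.R_add α β
  have e2 := h.R_sub α β
  apply mul_right_cancel₀ hD
  linear_combination e1 * (R (α - β) * (1 - R α ^ 2 * R β ^ 2)) + (R α * Y β + R β * Y α) * e2 +
    R α ^ 2 * h.curve β - R β ^ 2 * h.curve α

lemma norm_add_norm_eq {β γ : ℤ√(-2)} {δ : ℤ} {n : ℕ} (hδ : δ ^ 2 = 1) (hsub : β - γ = δ)
    (hn : (β + γ).norm = 2 * n + 1) : β.norm + γ.norm = n + 1 := by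
  have h1 := congrArg Zsqrtd.re hsub
  have h2 := congrArg Zsqrtd.im hsub
  simp only [Zsqrtd.re_sub, Zsqrtd.im_sub, Zsqrtd.re_intCast, Zsqrtd.im_intCast] at h1 h2
  simp only [Zsqrtd.norm_def, Zsqrtd.re_add, Zsqrtd.im_add] at hn ⊢
  rw [sub_eq_iff_eq_add.1 h1, sub_eq_iff_eq_add.1 h2] at hn ⊢
  linarith

/-- A multiple `[β + γ]` with `β - γ = ±1` is an odd polynomial divided by its reflection. -/
lemma exists_polynomial_of_sub [CharZero K] (hρ : ρ ^ 2 = 2)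
    (h : IsFormalMultiples ρ φ R Y) {β γ : ℤ√(-2)} {δ : ℤ} {n : ℕ} (hδ : δ ^ 2 = 1)
    (hsub : β - γ = δ) (hβ : Odd β.re) (hγ : Even γ.re) (hn : (β + γ).norm = 2 * n + 1) :
    ∃ (A : K[X]) (e : K), e ^ 2 = 1 ∧ A.natDegree ≤ 2 * n + 1 ∧ A.comp (-X) = -A ∧ A ≠ 0 ∧
      R (β + γ) * (C e * A.reflect (2 * n + 1) : K[X]) = (A : PowerSeries K) := by
  have hs : φ Zsqrtd.sqrtd ^ 2 = -2 := by
    rw [← map_pow, pow_two, Zsqrtd.dmuld, map_intCast]; norm_num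
  obtain ⟨x, hx, hR⟩ := h.exists_ratFunc
  have hnorm : (x β).height + (x γ).height = n + 1 := by
    zify
    rw [hx.height_eq_norm, hx.height_eq_norm, norm_add_norm_eq hδ hsub hn]
  obtain ⟨κ, hκ, -, hκβ⟩ := hx.reflect_num_denom hρ hs β
  obtain ⟨κ', hκ', hκγ, -⟩ := hx.reflect_num_denom hρ hs γ
  obtain ⟨b1, b2⟩ := hκβ hβ
  obtain ⟨c1, c2⟩ := hκγ hγ
  have num0 : ∀ α, (x α).num.coeff 0 = 0 := by
    intro α
    have := congrArg PowerSeries.constantCoeff (hR α)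
    rw [aeval_X_sq_eq, aeval_X_sq_eq, map_mul, map_pow, h.constR] at this
    simpa [coeff_zero_eq_eval_zero, expand_eval] using this.symm
  have den0 : ∀ α, (x α).denom.coeff 0 ≠ 0 := by
    intro α h0
    obtain ⟨a, b, hab⟩ := (x α).isCoprime_num_denom
    have := congrArg (coeff · 0) hab
    simp [mul_coeff_zero, h0, num0] at this
  have hRβ := hR β
  have hRγ := hR γ
  have dA := le_max_left (x β).num.natDegree (x β).denom.natDegree
  have dB := le_max_right (x β).num.natDegree (x β).denom.natDegree
  have dA' := le_max_left (x γ).num.natDegree (x γ).denom.natDegree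
  have dB' := le_max_right (x γ).num.natDegree (x γ).denom.natDegree
  change _ ≤ (x β).height at dA dB
  change _ ≤ (x γ).height at dA' dB'
  have nβ := num0 β
  have nγ := num0 γ
  have mβ := den0 β
  have mγ := den0 γ
  generalize (x β).num = A at *
  generalize (x β).denom = B at *
  generalize (x γ).num = A' at *
  generalize (x γ).denom = B' at *
  generalize (x β).height = m at *
  generalize (x γ).height = m' at *
  obtain ⟨N, hN⟩ : X ∣ A * B' - B * A' := by
    rw [X_dvd_iff]; simp [mul_coeff_zero, nβ, nγ]
  have hM0 : B * B' - A * A' ≠ 0 := by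
    intro h0
    have := congrArg (coeff · 0) h0
    simp [mul_coeff_zero, nβ, mβ, mγ] at this
  have hdN : N.natDegree ≤ n := by
    by_cases h0 : N = 0
    · simp [h0]
    · have : (A * B' - B * A').natDegree ≤ n + 1 := by
        rw [← hnorm]
        exact natDegree_sub_le_of_degree_le (natDegree_mul_le_of_le dA dB')
          (natDegree_mul_le_of_le dB dA')
      rw [hN, natDegree_X_mul h0] at this
      lia
  have hrefl : N.reflect n = C (κ * κ') * (B * B' - A * A') := by
    rw [← reflect_X_mul hdN, ← hN, ← hnorm, reflect_sub, reflect_mul _ _ dA dB',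
      reflect_mul _ _ dB dA', b1, b2, c1, c2, map_mul]
    ring
  have hκκ : (κ * κ') ^ 2 = 1 := by rw [mul_pow, hκ, hκ', one_mul]
  have hM : B * B' - A * A' = C (κ * κ') * N.reflect n := by
    rw [hrefl, ← mul_assoc, ← C_mul, ← pow_two, hκκ, map_one, one_mul]
  have hδK : (δ : K) ^ 2 = 1 := by exact_mod_cast congrArg (Int.cast : ℤ → K) hδ
  have hRδ : R δ = PowerSeries.C (δ : K) * PowerSeries.X := by
    rcases mul_self_eq_one_iff.1 ((pow_two δ).symm.trans hδ) with rfl | rfl <;> simp [h.R_one, h.R_neg]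
  have hodd : (X * expand K 2 N).comp (-X) = -(X * expand K 2 N) := by
    rw [mul_comp, expand_eq_comp_X_pow, comp_assoc]; simp
  refine ⟨X * expand K 2 N, κ * κ' * δ, by rw [mul_pow, hκκ, hδK, one_mul], ?_, hodd, ?_, ?_⟩
  · refine (natDegree_mul_le_of_le natDegree_X_le (natDegree_expand 2 N).le).trans ?_
    lia
  · intro h0
    have : N = 0 := by simpa [expand_eq_zero two_pos] using h0
    rw [this] at hM
    exact hM0 (by simpa using hM)
  · have hdE : (expand K 2 N).natDegree ≤ 2 * n := by rw [natDegree_expand]; lia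
    rw [reflect_X_mul hdE, reflect_expand_two]
    have e := h.prod_R β γ
    rw [hsub, hRδ] at e
    have hδs : PowerSeries.C (δ : K) ^ 2 = 1 := by rw [← map_pow, hδK, map_one]
    have e1 : R (β + γ) * PowerSeries.C (δ : K) * PowerSeries.X *
        aeval (PowerSeries.X ^ 2 : PowerSeries K) (B * B' - A * A') =
        aeval (PowerSeries.X ^ 2 : PowerSeries K) (A * B' - B * A') := by
      simp only [map_sub, map_mul]
      rw [← hRβ, ← hRγ]
      linear_combination aeval (PowerSeries.X ^ 2 : PowerSeries K) B *
        aeval (PowerSeries.X ^ 2 : PowerSeries K) B' * e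
    rw [hM, hN, aeval_X_sq_eq, aeval_X_sq_eq] at e1
    simp only [map_mul, expand_C, expand_X, Polynomial.coe_mul, coe_C,
      Polynomial.coe_pow, coe_X] at e1 ⊢
    apply mul_left_cancel₀ (PowerSeries.X_ne_zero (R := K))
    linear_combination e1

/-- Multiplication by an element `a + b√-2` with `a` odd and `b` even. -/
lemma exists_polynomial [CharZero K] (hρ : ρ ^ 2 = 2)
    (h : IsFormalMultiples ρ φ R Y) {π : ℤ√(-2)} {n : ℕ} (hre : Odd π.re) (him : Even π.im)
    (hn : π.norm = 2 * n + 1) :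
    ∃ (A : K[X]) (e : K), e ^ 2 = 1 ∧ A.natDegree ≤ 2 * n + 1 ∧ A.comp (-X) = -A ∧ A ≠ 0 ∧
      R π * (C e * A.reflect (2 * n + 1) : K[X]) = (A : PowerSeries K) := by
  obtain ⟨a, ha⟩ := hre
  obtain ⟨b, hb⟩ := him
  have e1 : (⟨a + 1, b⟩ + ⟨a, b⟩ : ℤ√(-2)) = π := by ext <;> simp <;> lia
  have e2 : (⟨a, b⟩ + ⟨a + 1, b⟩ : ℤ√(-2)) = π := by ext <;> simp <;> lia
  rcases Int.even_or_odd a with h0 | h0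
  · have := h.exists_polynomial_of_sub hρ (β := ⟨a + 1, b⟩) (γ := ⟨a, b⟩) (δ := 1) (by simp)
      (by ext <;> simp) h0.add_one h0 (by rw [e1, hn])
    rwa [e1] at this
  · have := h.exists_polynomial_of_sub hρ (β := ⟨a, b⟩) (γ := ⟨a + 1, b⟩) (δ := -1) (by simp)
      (by ext <;> simp) h0 h0.add_one (by rw [e2, hn])
    rwa [e2] at this

end IsFormalMultiples

open Polynomial in
/-- The multiplication by `π = a + b√-2` (`a` odd, `b` even) on `y² = 1 - 2ρt² + t⁴`, `ρ² = 2`. -/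
lemma exists_odd_polynomial {K : Type*} [Field K] [CharZero K] {ρ : K} (hρ : ρ ^ 2 = 2)
    {φ : ℤ√(-2) →+* K} {π : ℤ√(-2)} {n : ℕ} (hre : Odd π.re)
    (him : Even π.im) (hn : π.norm = 2 * n + 1) :
    ∃ (A B : K[X]) (e : K), e ^ 2 = 1 ∧ A.natDegree ≤ 2 * n + 1 ∧ A.comp (-X) = -A ∧ A ≠ 0 ∧
      B = C e * A.reflect (2 * n + 1) ∧
      (derivative A * B - A * derivative B) ^ 2 * (1 - 2 * C ρ * X ^ 2 + X ^ 4) =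
        C (φ π) ^ 2 * (B ^ 4 - 2 * C ρ * A ^ 2 * B ^ 2 + A ^ 4) := by
  obtain ⟨R, Y, h⟩ := exists_isFormalMultiples hρ φ
  obtain ⟨A, e, he, hd, hodd, hA, hR⟩ := h.exists_polynomial hρ hre him hn
  refine ⟨A, _, e, he, hd, hodd, hA, rfl, ?_⟩
  generalize C e * A.reflect (2 * n + 1) = B at *
  rw [← Polynomial.coe_inj]
  have e1 := congrArg (PowerSeries.derivative K) hR
  rw [Derivation.leibniz, PowerSeries.derivative_coe, PowerSeries.derivative_coe, smul_eq_mul,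
    smul_eq_mul] at e1
  have e2 := h.derivR π
  have e3 := h.curve 1
  have e4 := h.curve π
  rw [h.R_one] at e3
  have h2 : ((2 : K[X]) : PowerSeries K) = 2 := by
    rw [show (2 : K[X]) = C 2 from (map_ofNat C 2).symm, coe_C, map_ofNat]
  simp only [Polynomial.coe_mul, Polynomial.coe_add, Polynomial.coe_sub, Polynomial.coe_pow, coe_X,
    coe_C, Polynomial.coe_one, h2]
  rw [← e3, ← e1, ← hR]
  generalize PowerSeries.derivative K (R π) = R' at *
  have e5 := congrArg (· ^ 2) e2
  beta_reduce at e5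
  linear_combination (B : PowerSeries K) ^ 4 * e5 +
    (B : PowerSeries K) ^ 4 * PowerSeries.C (φ π) ^ 2 * e4

namespace Polynomial

lemma coeff_comp_neg_X' {R : Type*} [CommRing R] (q : R[X]) (i : ℕ) :
    (q.comp (-X)).coeff i = q.coeff i * (-1) ^ i := by
  rw [← neg_one_mul (X : R[X]), ← C_1, ← C_neg, comp_C_mul_X_coeff]

lemma reflect_pow {R : Type*} [CommSemiring R] {q : R[X]} (h : q.natDegree ≤ 1) (k : ℕ) :
    (q ^ k).reflect k = q.reflect 1 ^ k := by
  induction k with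
  | zero => simp
  | succ k ih =>
    rw [pow_succ, reflect_mul _ _ (F := k) (by simpa using natDegree_pow_le_of_le k h) h, ih, pow_succ]

lemma natDegree_one_add_X_le {R : Type*} [CommRing R] : (1 + X : R[X]).natDegree ≤ 1 := by
  compute_degree

lemma natDegree_one_sub_X_le {R : Type*} [CommRing R] : (1 - X : R[X]).natDegree ≤ 1 := by
  compute_degree

/-- The substitution `t = (1 - z) / (1 + z)` in a polynomial of degree at most `N`. -/
noncomputable def cayley {K : Type*} [Field K] (N : ℕ) (q : K[X]) : K[X] :=
  ∑ i ∈ range (N + 1), C (q.coeff i) * ((1 - X) ^ i * (1 + X) ^ (N - i))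

section cayley

variable {K : Type*} [Field K] {N : ℕ}

lemma natDegree_cayley_le (q : K[X]) : (cayley N q).natDegree ≤ N := by
  refine natDegree_sum_le_of_forall_le _ _ fun i hi => ?_
  refine (natDegree_C_mul_le _ _).trans ?_
  refine (natDegree_mul_le_of_le (natDegree_pow_le_of_le i natDegree_one_sub_X_le)
    (natDegree_pow_le_of_le (N - i) natDegree_one_add_X_le)).trans ?_
  rw [mem_range] at hi
  lia

lemma cayley_comp_neg_X (q : K[X]) : (cayley N q).comp (-X) = cayley N (q.reflect N) := by
  rw [cayley, cayley, ← sum_range_reflect, Polynomial.sum_comp]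
  refine sum_congr rfl fun i hi => ?_
  rw [mem_range] at hi
  rw [coeff_reflect, show N + 1 - 1 - i = N - i by lia, revAt_le (by lia)]
  have : N - (N - i) = i := by lia
  simp only [this, mul_comp, C_comp, pow_comp, sub_comp, add_comp, one_comp, X_comp]
  ring

lemma reflect_cayley (q : K[X]) : (cayley N q).reflect N = cayley N (q.comp (-X)) := by
  rw [cayley, cayley]
  have hs : ∀ f : ℕ → K[X], (∑ i ∈ range (N + 1), f i).reflect N =
      ∑ i ∈ range (N + 1), (f i).reflect N := fun f =>
    map_sum (⟨⟨reflect N, reflect_zero⟩, fun f g => reflect_add f g N⟩ : K[X] →+ K[X]) f (range (N + 1))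
  rw [hs]
  refine sum_congr rfl fun i hi => ?_
  rw [mem_range] at hi
  have e := reflect_mul ((1 - X : K[X]) ^ i) ((1 + X) ^ (N - i)) (F := i) (G := N - i)
    (by simpa only [mul_one] using natDegree_pow_le_of_le i (natDegree_one_sub_X_le (R := K)))
    (by simpa only [mul_one] using natDegree_pow_le_of_le (N - i) (natDegree_one_add_X_le (R := K)))
  rw [Nat.add_sub_cancel' (by lia), reflect_pow natDegree_one_sub_X_le,
    reflect_pow natDegree_one_add_X_le, reflect_sub, reflect_add] at e
  have e1 : (X : K[X]).reflect 1 = 1 := by simp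
  have e2 : (1 : K[X]).reflect 1 = X := by simp
  rw [e1, e2] at e
  rw [reflect_C_mul, e, coeff_comp_neg_X', map_mul, map_pow, map_neg, map_one, add_comm X]
  have : (X - 1 : K[X]) ^ i = (-1) ^ i * (1 - X) ^ i := by rw [← mul_pow]; ring
  rw [this]; ring

lemma cayley_injective [CharZero K] {q : K[X]} (hq : q.natDegree ≤ N) (h : cayley N q = 0) :
    q = 0 := by
  have key : ∀ t, (1 + t) * eval t q = 0 := by
    intro t
    by_cases ht : 1 + t = 0
    · rw [ht, zero_mul]
    · have e := congrArg (fun f => (1 + t) ^ N * eval ((1 - t) / (1 + t)) f) h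
      simp only [cayley, eval_finsetSum, eval_mul, eval_C, eval_pow, eval_sub, eval_add, eval_one,
        eval_X, eval_zero, mul_zero, mul_sum] at e
      have e2 : eval t q * 2 ^ N = 0 := by
        rw [← e, eval_eq_sum_range' (Nat.lt_succ_of_le hq), sum_mul]
        refine sum_congr rfl fun i hi => ?_
        rw [mem_range] at hi
        have h1 : 1 - (1 - t) / (1 + t) = 2 * t / (1 + t) := by field_simp; ring
        have h2 : 1 + (1 - t) / (1 + t) = 2 / (1 + t) := by field_simp; ring
        obtain ⟨k, rfl⟩ := Nat.exists_eq_add_of_le (Nat.lt_succ_iff.1 hi)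
        rw [h1, h2, Nat.add_sub_cancel_left, pow_add, pow_add, div_pow, div_pow]
        field_simp
        ring
      rw [(mul_eq_zero.1 e2).resolve_right (by simp), mul_zero]
  have : (1 + X) * q = 0 := by
    apply funext
    intro t
    simpa using key t
  refine (mul_eq_zero.1 this).resolve_left fun h0 => ?_
  have := congrArg (coeff · 1) h0
  simp [coeff_one] at this

lemma coe_cayley {q : K[X]} (hq : q.natDegree ≤ N) {c : PowerSeries K}
    (hc : c * (1 + PowerSeries.X) = 1 - PowerSeries.X) :
    (cayley N q : PowerSeries K) = (1 + PowerSeries.X) ^ N * aeval c q := by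
  rw [cayley, aeval_eq_sum_range' (Nat.lt_succ_of_le hq), mul_sum,
    ← coeToPowerSeries.ringHom_apply, map_sum]
  refine sum_congr rfl fun i hi => ?_
  rw [mem_range] at hi
  simp only [coeToPowerSeries.ringHom_apply, Polynomial.coe_mul, Polynomial.coe_pow, coe_C,
    Polynomial.coe_sub, Polynomial.coe_add, Polynomial.coe_one, coe_X]
  obtain ⟨k, rfl⟩ := Nat.exists_eq_add_of_le (Nat.lt_succ_iff.1 hi)
  rw [← hc, PowerSeries.smul_eq_C_mul, Nat.add_sub_cancel_left, mul_pow]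
  ring

end cayley

end Polynomial

open Polynomial in
/-- The multiplication by `π` on the isomorphic curve `y² = 1 - 2(5 + 4ρ)z² + z⁴`. -/
lemma exists_odd_polynomial' {K : Type*} [Field K] [CharZero K] {ρ : K} (hρ : ρ ^ 2 = 2)
    {φ : ℤ√(-2) →+* K} {π : ℤ√(-2)} {n : ℕ} (hre : Odd π.re)
    (him : Even π.im) (hn : π.norm = 2 * n + 1) :
    ∃ A : K[X], A.natDegree ≤ 2 * n + 1 ∧ A.comp (-X) = -A ∧ A ≠ 0 ∧
      (derivative A * A.reflect (2 * n + 1) - A * derivative (A.reflect (2 * n + 1))) ^ 2 *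
        (1 - 2 * C (5 + 4 * ρ) * X ^ 2 + X ^ 4) =
      C (φ π) ^ 2 * (A.reflect (2 * n + 1) ^ 4 - 2 * C (5 + 4 * ρ) * A ^ 2 *
        A.reflect (2 * n + 1) ^ 2 + A ^ 4) := by
  obtain ⟨A, B, e, he, hd, hodd, hA, hB, hODE⟩ := exists_odd_polynomial hρ hre him hn
  set N := 2 * n + 1 with hN
  have hdB : B.natDegree ≤ N := by
    rw [hB]; exact (natDegree_C_mul_le _ _).trans (natDegree_reflect_le_of_le hd)
  have hd1 : (B - C e * A).natDegree ≤ N :=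
    natDegree_sub_le_of_degree_le hdB ((natDegree_C_mul_le _ _).trans hd)
  have hd2 : (B + C e * A).natDegree ≤ N :=
    natDegree_add_le_of_degree_le hdB ((natDegree_C_mul_le _ _).trans hd)
  have hee : C e * C e = (1 : K[X]) := by rw [← C_mul, ← pow_two, he, C_1]
  have rB : B.reflect N = C e * A := by rw [hB, reflect_C_mul, reflect_reflect]
  have rA : (C e * A).reflect N = B := by rw [reflect_C_mul, hB]
  have eB : B.comp (-X) = B := by
    ext i
    have hi := congrArg (coeff · (revAt N i)) hodd
    simp only [coeff_comp_neg_X', coeff_neg] at hi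
    rw [coeff_comp_neg_X', hB, coeff_C_mul, coeff_reflect]
    rcases le_or_gt i N with h | h
    · rw [revAt_le h] at hi ⊢
      rcases Nat.even_or_odd i with h2 | h2
      · rw [h2.neg_one_pow, mul_one]
      · have : Even (N - i) := by
          rw [Nat.even_sub h]
          exact iff_of_false (by simp [hN]) (Nat.not_even_iff_odd.2 h2)
        rw [this.neg_one_pow, mul_one] at hi
        rw [self_eq_neg.1 hi]; ring
    · rw [revAt_eq_self_of_lt h, coeff_eq_zero_of_natDegree_lt (by lia)]; ring
  have hlin : ∀ P Q : K[X], cayley N (P - Q) = cayley N P - cayley N Q := by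
    intro P Q; simp [cayley, sub_mul]
  have eref : (cayley N (B - C e * A)).reflect N = cayley N (B + C e * A) := by
    rw [reflect_cayley, sub_comp, eB, mul_comp, hodd]
    congr 1; simp
  refine ⟨cayley N (B - C e * A), natDegree_cayley_le _, ?_, ?_, ?_⟩
  · rw [cayley_comp_neg_X, reflect_sub, rA, rB, hlin, hlin, neg_sub]
  · intro h0
    have h1 := cayley_injective hd1 h0
    have h2 := cayley_injective hd2 (by rw [← eref, h0, reflect_zero])
    have h3 : C (2 * e) * A = 0 := by
      rw [C_mul, map_ofNat]
      linear_combination h2 - h1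
    have h4 : (2 * e) ≠ 0 := mul_ne_zero two_ne_zero (by rintro rfl; simp at he)
    exact hA ((mul_eq_zero.1 h3).resolve_left (by simpa using h4))
  · rw [eref]
    have hu : (1 + PowerSeries.X : PowerSeries K) ≠ 0 :=
      IsFormalPoint.ne_zero_of_constantCoeff (a := 1) (by simp) one_ne_zero
    obtain ⟨c, hc⟩ : ∃ c : PowerSeries K, c * (1 + PowerSeries.X) = 1 - PowerSeries.X := by
      refine ⟨(1 - PowerSeries.X) * (1 + PowerSeries.X)⁻¹, ?_⟩
      rw [mul_assoc, PowerSeries.inv_mul_cancel _ (by simp), mul_one]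
    have hc' : PowerSeries.derivative K c * (1 + PowerSeries.X) ^ 2 = -2 := by
      have := congrArg (PowerSeries.derivative K) hc
      simp only [Derivation.leibniz, map_add, map_sub, PowerSeries.derivative_X,
        PowerSeries.derivative_one, smul_eq_mul] at this
      linear_combination (1 + PowerSeries.X) * this - hc
    have hder : ∀ q : K[X], q.natDegree ≤ N → ((derivative (cayley N q) : K[X]) : PowerSeries K) *
        (1 + PowerSeries.X) ^ 2 = (N : PowerSeries K) * (1 + PowerSeries.X) * ((cayley N q : K[X]) : PowerSeries K) -
          2 * (1 + PowerSeries.X) ^ N * aeval c (derivative q) := by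
      intro q hq
      rw [← PowerSeries.derivative_coe, coe_cayley hq hc, Derivation.leibniz, Derivation.map_aeval,
        Derivation.leibniz_pow]
      simp only [map_add, PowerSeries.derivative_X, PowerSeries.derivative_one, smul_eq_mul,
        nsmul_eq_mul, hN, Nat.add_sub_cancel]
      linear_combination (1 + PowerSeries.X) ^ (2 * n + 1) * aeval c (derivative q) * hc'
    have f1 := hder _ hd1
    have f2 := hder _ hd2
    rw [← Polynomial.coe_inj]
    have hC : ∀ a : K, algebraMap K (PowerSeries K) a = PowerSeries.C a := fun a => rfl
    have h2 : ((2 : K[X]) : PowerSeries K) = 2 := by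
      rw [show (2 : K[X]) = C 2 from (map_ofNat C 2).symm, coe_C, map_ofNat]
    have h5 : PowerSeries.C (5 + 4 * ρ) = 5 + 4 * PowerSeries.C ρ := by
      rw [map_add, map_mul, map_ofNat, map_ofNat]
    have hee' : PowerSeries.C e ^ 2 = (1 : PowerSeries K) := by rw [← map_pow, he, map_one]
    have hρ' : PowerSeries.C ρ ^ 2 = (2 : PowerSeries K) := by rw [← map_pow, hρ, map_ofNat]
    simp only [Polynomial.coe_mul, Polynomial.coe_add, Polynomial.coe_sub, Polynomial.coe_pow, coe_X,
      coe_C, Polynomial.coe_one, h2, h5]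
    have hODE' := congrArg (aeval c) hODE
    simp only [map_mul, map_sub, map_add, map_pow, map_ofNat, aeval_C, hC, map_one, aeval_X] at hODE'
    have g1 := coe_cayley hd1 hc
    have g2 := coe_cayley hd2 hc
    simp only [map_mul, map_sub, map_add, aeval_C, hC, derivative_C, zero_mul, zero_add,
      derivative_mul] at f1 f2 g1 g2
    generalize (cayley N (B - C e * A)) = P at *
    generalize (cayley N (B + C e * A)) = Q at *
    generalize aeval c (derivative A) = a1 at *
    generalize aeval c (derivative B) = b1 at *
    generalize aeval c A = a at *
    generalize aeval c B = b at *
    generalize ((derivative P : K[X]) : PowerSeries K) = P' at *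
    generalize ((derivative Q : K[X]) : PowerSeries K) = Q' at *
    generalize (P : PowerSeries K) = P at *
    generalize (Q : PowerSeries K) = Q at *
    set U : PowerSeries K := 1 + PowerSeries.X with hU
    have hW : (P' * Q - P * Q') * U ^ 2 =
        4 * PowerSeries.C e * (U ^ N) ^ 2 * (a1 * b - a * b1) := by
      linear_combination Q * f1 - P * f2 - 2 * U ^ N * (b1 - PowerSeries.C e * a1) * g2 +
        2 * U ^ N * (b1 + PowerSeries.C e * a1) * g1
    have hf : 2 * (1 - 2 * (5 + 4 * PowerSeries.C ρ) * PowerSeries.X ^ 2 + PowerSeries.X ^ 4) =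
        -(1 + PowerSeries.C ρ) * (1 - 2 * PowerSeries.C ρ * c ^ 2 + c ^ 4) * U ^ 4 := by
      have h4 : (1 - 2 * PowerSeries.C ρ * c ^ 2 + c ^ 4) * U ^ 4 =
          U ^ 4 - 2 * PowerSeries.C ρ * U ^ 2 * (1 - PowerSeries.X) ^ 2 + (1 - PowerSeries.X) ^ 4 := by
        rw [← hc]; ring
      rw [mul_assoc (-(1 + PowerSeries.C ρ)), h4, hU]
      linear_combination -(2 * PowerSeries.X ^ 4 - 4 * PowerSeries.X ^ 2 + 2) * hρ'
    have hF : Q ^ 4 - 2 * (5 + 4 * PowerSeries.C ρ) * P ^ 2 * Q ^ 2 + P ^ 4 =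
        -8 * (1 + PowerSeries.C ρ) * (U ^ N) ^ 4 *
          (b ^ 4 - 2 * PowerSeries.C ρ * a ^ 2 * b ^ 2 + a ^ 4) := by
      rw [g1, g2]
      linear_combination (U ^ N) ^ 4 * (-16 * a ^ 2 * b ^ 2 * hρ' + (12 * a ^ 2 * b ^ 2 +
        (5 + 4 * PowerSeries.C ρ) * 4 * a ^ 2 * b ^ 2 - (8 + 8 * PowerSeries.C ρ) * a ^ 4 *
          (PowerSeries.C e ^ 2 + 1)) * hee')
    have h20 : (2 * U ^ 4 : PowerSeries K) ≠ 0 := by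
      refine mul_ne_zero ?_ (pow_ne_zero 4 hu)
      rw [show (2 : PowerSeries K) = PowerSeries.C 2 from (map_ofNat PowerSeries.C 2).symm]
      simp
    apply mul_left_cancel₀ h20
    have hW2 := congrArg (· ^ 2) hW
    beta_reduce at hW2
    rw [hF]
    generalize 1 - 2 * (5 + 4 * PowerSeries.C ρ) * PowerSeries.X ^ 2 + PowerSeries.X ^ 4 = fD at *
    linear_combination 2 * fD * hW2 +
      16 * PowerSeries.C e ^ 2 * (U ^ N) ^ 4 * (a1 * b - a * b1) ^ 2 * hf -
      16 * PowerSeries.C e ^ 2 * (U ^ N) ^ 4 * (1 + PowerSeries.C ρ) * U ^ 4 * hODE' -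
      16 * (U ^ N) ^ 4 * (1 + PowerSeries.C ρ) * U ^ 4 * PowerSeries.C (φ π) ^ 2 *
        (b ^ 4 - 2 * PowerSeries.C ρ * a ^ 2 * b ^ 2 + a ^ 4) * hee'

/-- The coefficient of `X^(p-1)` in `(1 - 2aX² + X⁴)^(-1/2)` modulo `p²`, read off from a lift `A/B`
of the Frobenius map which multiplies the invariant differential by `pc`. -/
lemma exists_sq_eq_and_dvd_coeff {R : Type*} [CommRing R] [IsDomain R] {p : ℕ} (hp : 1 < p)
    (hp0 : (p : R) ≠ 0) (h2 : IsUnit (2 : R)) {a c : R} (hc : IsUnit c)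
    {M D : Polynomial R} (hM : M.coeff p = 0) (hM0 : M.coeff 0 = 0)
    (hD0 : D.coeff 0 = 0) {A B : Polynomial R}
    (hA : A = Polynomial.X ^ p + Polynomial.C (p : R) * M)
    (hB : B = 1 + Polynomial.C (p : R) * D)
    (hODE : (Polynomial.derivative A * B - A * Polynomial.derivative B) ^ 2 *
        (1 - 2 * Polynomial.C a * Polynomial.X ^ 2 + Polynomial.X ^ 4) =
      Polynomial.C ((p : R) * c) ^ 2 * (B ^ 4 - 2 * Polynomial.C a * A ^ 2 * B ^ 2 + A ^ 4))
    {Ψ : PowerSeries R} (hΨ0 : PowerSeries.constantCoeff Ψ = 1)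
    (hΨ : PowerSeries.X ^ p ∣ Ψ ^ 2 * (1 - 2 * PowerSeries.C a * PowerSeries.X ^ 2 +
      PowerSeries.X ^ 4) - 1) :
    ∃ c' : R, c' ^ 2 = c ^ 2 ∧ (p : R) ^ 2 ∣ c' * PowerSeries.coeff (p - 1) Ψ - 1 := by
  set w : Polynomial R := (Polynomial.X ^ (p - 1) + Polynomial.derivative M) * B -
    A * Polynomial.derivative D with hw
  have hW : Polynomial.derivative A * B - A * Polynomial.derivative B = Polynomial.C (p : R) * w := by
    rw [hw, hA, hB]
    simp only [Polynomial.derivative_add, Polynomial.derivative_X_pow, Polynomial.derivative_mul,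
      Polynomial.derivative_C, Polynomial.derivative_one]
    ring
  have hODE' : w ^ 2 * (1 - 2 * Polynomial.C a * Polynomial.X ^ 2 + Polynomial.X ^ 4) =
      Polynomial.C c ^ 2 * (B ^ 4 - 2 * Polynomial.C a * A ^ 2 * B ^ 2 + A ^ 4) := by
    have : (Polynomial.C (p : R)) ^ 2 ≠ 0 := pow_ne_zero 2 (by rwa [Ne, Polynomial.C_eq_zero])
    apply mul_left_cancel₀ this
    rw [hW, map_mul] at hODE
    linear_combination hODE
  have hAe : Polynomial.eval 0 A = 0 := by
    rw [hA]; simp [← Polynomial.coeff_zero_eq_eval_zero, hM0]; lia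
  have hBe : Polynomial.eval 0 B = 1 := by
    rw [hB]; simp [← Polynomial.coeff_zero_eq_eval_zero, hD0]
  set c' := Polynomial.eval 0 w with hc'
  have hcc : c' ^ 2 = c ^ 2 := by
    have := congrArg (Polynomial.eval 0) hODE'
    simpa [hAe, hBe] using this
  refine ⟨c', hcc, ?_⟩
  have hc'u : IsUnit c' := (isUnit_pow_iff two_ne_zero).1 (hcc ▸ hc.pow 2)
  set I : Ideal (PowerSeries R) := Ideal.span {PowerSeries.C (p : R) ^ 2, PowerSeries.X ^ p} with hI
  suffices h : PowerSeries.C c' * Ψ - (PowerSeries.X ^ (p - 1) +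
      ((Polynomial.derivative (M - Polynomial.C (p : R) * (M * D)) -
        Polynomial.C (p : R) * D * Polynomial.X ^ (p - 1) : Polynomial R) : PowerSeries R)) ∈ I by
    obtain ⟨u, v, huv⟩ := Ideal.mem_span_pair.1 h
    have := congrArg (PowerSeries.coeff (p - 1)) huv
    have e1 : PowerSeries.coeff (p - 1) (v * PowerSeries.X ^ p) = 0 := by
      rw [PowerSeries.coeff_mul_X_pow', if_neg (by lia)]
    have e2 : PowerSeries.coeff (p - 1) (u * PowerSeries.C (p : R) ^ 2) =
        PowerSeries.coeff (p - 1) u * (p : R) ^ 2 := by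
      rw [← map_pow, PowerSeries.coeff_mul_C]
    have e3 : (Polynomial.C (p : R) * D * Polynomial.X ^ (p - 1)).coeff (p - 1) = 0 := by
      rw [Polynomial.coeff_mul_X_pow', if_pos le_rfl, Nat.sub_self]; simp [hD0]
    have hp1 : p - 1 + 1 = p := by lia
    have e4 : (((p - 1 : ℕ) : R) + 1) = (p : R) := by exact_mod_cast congrArg (Nat.cast (R := R)) hp1
    rw [map_add, e1, e2, map_sub, map_add, PowerSeries.coeff_C_mul, Polynomial.coeff_coe,
      Polynomial.coeff_sub, e3, Polynomial.coeff_derivative, hp1, e4, Polynomial.coeff_sub, hM,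
      PowerSeries.coeff_X_pow, if_pos rfl, Polynomial.coeff_C_mul] at this
    exact ⟨PowerSeries.coeff (p - 1) u - (M * D).coeff p, by linear_combination -this⟩
  have hX : PowerSeries.X ^ p ∈ I := Ideal.subset_span (by simp)
  have hpI : PowerSeries.C (p : R) ^ 2 ∈ I := Ideal.subset_span (by simp)
  rw [← Ideal.Quotient.eq_zero_iff_mem] at hX hpI ⊢
  obtain ⟨v, hv⟩ := hΨ
  set m := Ideal.Quotient.mk I
  have hΨm := congrArg m hv
  have hOm := congrArg (fun q : Polynomial R => m (q : PowerSeries R)) hODE'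
  have hAm := congrArg (fun q : Polynomial R => m (q : PowerSeries R)) hA
  have hBm := congrArg (fun q : Polynomial R => m (q : PowerSeries R)) hB
  have hwm := congrArg (fun q : Polynomial R => m (q : PowerSeries R)) hw
  have h2' : ((2 : Polynomial R) : PowerSeries R) = 2 := by
    rw [show (2 : Polynomial R) = Polynomial.C 2 from (map_ofNat Polynomial.C 2).symm,
      Polynomial.coe_C, map_ofNat]
  have hunit : IsUnit (m ((w : PowerSeries R) + PowerSeries.C c' * Ψ * (B : PowerSeries R) ^ 2)) := by
    apply IsUnit.map
    rw [PowerSeries.isUnit_iff_constantCoeff]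
    have : PowerSeries.constantCoeff ((w : PowerSeries R) + PowerSeries.C c' * Ψ *
        (B : PowerSeries R) ^ 2) = 2 * c' := by
      simp [hΨ0, hBe, ← hc', Polynomial.coeff_zero_eq_eval_zero]
      ring
    rw [this]
    exact h2.mul hc'u
  have hccm := congrArg (fun t => m (PowerSeries.C t)) hcc
  simp only [Polynomial.coe_mul, Polynomial.coe_add, Polynomial.coe_sub, Polynomial.coe_pow,
    Polynomial.coe_X, Polynomial.coe_C, Polynomial.coe_one, h2',
    Polynomial.derivative_mul, Polynomial.derivative_C, zero_mul, zero_add,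
    map_mul, map_add, map_sub, map_pow, map_one, map_ofNat] at *
  generalize m (w : PowerSeries R) = w at *
  generalize m (A : PowerSeries R) = A at *
  generalize m (B : PowerSeries R) = B at *
  generalize m ((Polynomial.derivative M : Polynomial R) : PowerSeries R) = M' at *
  generalize m ((Polynomial.derivative D : Polynomial R) : PowerSeries R) = D' at *
  generalize m (M : PowerSeries R) = M at *
  generalize m (D : PowerSeries R) = D at *
  generalize m Ψ = Ψ at *
  generalize m (PowerSeries.C c) = c at *
  generalize m (PowerSeries.C c') = c' at *
  generalize m (PowerSeries.C (p : R)) = P at *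
  generalize m (PowerSeries.C a) = a at *
  generalize m v = v at *
  have hXX : m PowerSeries.X ^ (p - 1) * m PowerSeries.X = 0 := by
    rw [← pow_succ, Nat.sub_add_cancel hp.le, hX]
  generalize m PowerSeries.X ^ p = Xp at *
  generalize m PowerSeries.X ^ (p - 1) = X1 at *
  generalize m PowerSeries.X = X at *
  have hA2 : A ^ 2 = 0 := by
    rw [hAm, hX]; linear_combination M ^ 2 * hpI
  have hprod : (w + c' * Ψ * B ^ 2) * (w - c' * Ψ * B ^ 2) = 0 := by
    linear_combination Ψ ^ 2 * hOm - w ^ 2 * hΨm - w ^ 2 * v * hX - Ψ ^ 2 * B ^ 4 * hccm +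
      Ψ ^ 2 * c ^ 2 * (A ^ 2 - 2 * a * B ^ 2) * hA2
  have hw' : w - c' * Ψ * B ^ 2 = 0 := hunit.mul_right_eq_zero.1 hprod
  subst hBm
  have hA' : A = P * M := by rw [hAm, hX, zero_add]
  rw [hA'] at hwm
  linear_combination (1 - 2 * P * D) * (hwm - hw') +
    (c' * Ψ * (3 * D ^ 2 + 2 * P * D ^ 3) - 2 * D ^ 2 * (X1 + M') + 2 * M * D * D') * hpI

namespace Polynomial

/-- An odd polynomial of degree at most `p` in characteristic `p` whose Wronskian with its
reflection vanishes is a monomial. -/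
lemma eq_C_mul_X_pow_of_wronskian_reflect_eq_zero {k : Type*} [Field k] {p : ℕ} [CharP k p]
    [Fact p.Prime] (hp2 : p ≠ 2) {A : k[X]} (hA0 : A ≠ 0) (hdeg : A.natDegree ≤ p)
    (hodd : A.comp (-X) = -A)
    (hW : derivative A * A.reflect p - A * derivative (A.reflect p) = 0) :
    ∃ c : k, A = C c * X ^ p := by
  have hp : p.Prime := Fact.out
  have hpo : Odd p := hp.odd_of_ne_two hp2
  have h2 : (2 : k) ≠ 0 := fun h ↦ hp2 <| by
    have : p ∣ 2 := (CharP.cast_eq_zero_iff k p 2).1 (by exact_mod_cast h)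
    exact (Nat.prime_dvd_prime_iff_eq hp Nat.prime_two).1 this
  have hAodd : ∀ i, A.coeff i ≠ 0 → Odd i := by
    intro i hi
    by_contra h
    rw [Nat.not_odd_iff_even] at h
    have := congrArg (fun q ↦ coeff q i) hodd
    simp only [coeff_comp_neg_X', h.neg_one_pow, coeff_neg, mul_one] at this
    exact hi (by
      have h' : 2 * A.coeff i = 0 := by linear_combination this
      exact (mul_eq_zero.1 h').resolve_left h2)
  have hB0 : A.reflect p ≠ 0 := by rwa [Ne, reflect_eq_zero_iff]
  have hBdeg : (A.reflect p).natDegree ≤ p := natDegree_reflect_le_of_le hdeg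
  obtain ⟨a, ha, ha0⟩ := exists_eq_pow_rootMultiplicity_mul_and_not_dvd A hA0 0
  obtain ⟨b, hb, hb0⟩ := exists_eq_pow_rootMultiplicity_mul_and_not_dvd (A.reflect p) hB0 0
  generalize rootMultiplicity 0 A = m at *
  generalize rootMultiplicity 0 (A.reflect p) = l at *
  simp only [map_zero, sub_zero, X_dvd_iff] at *
  have hm : A.coeff m = a.coeff 0 := by rw [ha]; simpa using coeff_X_pow_mul a m 0
  have hl : (A.reflect p).coeff l = b.coeff 0 := by rw [hb]; simpa using coeff_X_pow_mul b l 0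
  have hmo : Odd m := hAodd m (by rwa [hm])
  have hmp : m ≤ p := (le_natDegree_of_ne_zero (by rwa [hm])).trans hdeg
  have hlp : l ≤ p := (le_natDegree_of_ne_zero (by rwa [hl])).trans hBdeg
  have hlo : Odd (p - l) := hAodd _ (by
    rw [coeff_reflect, revAt_le hlp] at hl
    rwa [hl])
  have hml : (m : k) = l := by
    have hx (n : ℕ) : X * derivative (X ^ n : k[X]) = C (n : k) * X ^ n := by
      rw [derivative_X_pow]
      cases n <;> simp [pow_succ]; ring
    have h : (X : k[X]) ^ (m + l) *
        ((C (m : k) - C (l : k)) * a * b + X * (derivative a * b - a * derivative b)) = 0 := by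
      have h1 := hx m
      have h2 := hx l
      rw [hb, ha] at hW
      simp only [derivative_mul] at hW
      rw [pow_add]
      linear_combination X * hW - h1 * X ^ l * a * b + h2 * X ^ m * a * b
    have h' := (mul_eq_zero.1 h).resolve_left (pow_ne_zero _ X_ne_zero)
    have h'' := congrArg (fun q ↦ coeff q 0) h'
    simp only [coeff_add, mul_coeff_zero, coeff_sub, coeff_C_zero, coeff_X_zero, zero_mul,
      add_zero, coeff_zero] at h''
    exact sub_eq_zero.1 ((mul_eq_zero.1 ((mul_eq_zero.1 h'').resolve_right hb0)).resolve_right ha0)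
  have hmod : m ≡ l [MOD p] := (CharP.natCast_eq_natCast k p).1 hml
  have hmeq : m = p := by
    rcases Nat.lt_or_ge m p with h | h
    · rcases Nat.lt_or_ge l p with h' | h'
      · have := Nat.ModEq.eq_of_lt_of_lt hmod h h'
        grind
      · have hlp' : l = p := le_antisymm hlp h'
        rw [hlp'] at hlo
        simp at hlo
    · exact le_antisymm hmp h
  subst hmeq
  have hadeg : a.natDegree = 0 := by
    have ha' : a ≠ 0 := by rintro rfl; simp at ha0
    have := natDegree_mul (pow_ne_zero m (X_ne_zero (R := k))) ha'
    rw [← ha, natDegree_X_pow] at this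
    lia
  refine ⟨a.coeff 0, ?_⟩
  conv_lhs => rw [ha, eq_C_of_natDegree_eq_zero hadeg]
  ring

end Polynomial

/-- A nonzero polynomial over `ℚ_p` has a primitive multiple over `ℤ_p`. -/
lemma PadicInt.exists_map_eq_C_mul {p : ℕ} [Fact p.Prime] {A : Polynomial ℚ_[p]} (hA : A ≠ 0) :
    ∃ c : ℚ_[p], c ≠ 0 ∧ ∃ A₀ : Polynomial ℤ_[p],
      A₀.map PadicInt.Coe.ringHom = Polynomial.C c * A ∧ ∃ i, A₀.coeff i = 1 := by
  obtain ⟨i, hi, hmax⟩ := exists_max_image A.support (fun i ↦ ‖A.coeff i‖)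
    (Polynomial.support_nonempty.2 hA)
  have hi0 : A.coeff i ≠ 0 := Polynomial.mem_support_iff.1 hi
  have hle (j : ℕ) : ‖(A.coeff i)⁻¹ * A.coeff j‖ ≤ 1 := by
    rw [norm_mul, norm_inv, inv_mul_le_one₀ (norm_pos_iff.2 hi0)]
    by_cases hj : A.coeff j = 0
    · simp [hj]
    · exact hmax j (Polynomial.mem_support_iff.2 hj)
  have hlift : Polynomial.C (A.coeff i)⁻¹ * A ∈ Polynomial.lifts (PadicInt.Coe.ringHom (p := p)) := by
    rw [Polynomial.lifts_iff_coeff_lifts]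
    intro j
    rw [Polynomial.coeff_C_mul]
    exact ⟨⟨_, hle j⟩, rfl⟩
  obtain ⟨A₀, hA₀⟩ := hlift
  refine ⟨_, inv_ne_zero hi0, A₀, hA₀, i, ?_⟩
  have := congrArg (fun q ↦ q.coeff i) hA₀
  simp only [Polynomial.coe_mapRingHom, Polynomial.coeff_map, Polynomial.coeff_C_mul,
    inv_mul_cancel₀ hi0] at this
  exact PadicInt.ext this

/-- An algebraic multiplication by `π = pc` defined over `ℚ_p` is, after scaling, congruent to the
Frobenius map. -/
lemma PadicInt.exists_eq_X_pow_add {p : ℕ} [Fact p.Prime] (hp2 : p ≠ 2) {a c : ℤ_[p]}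
    {A : Polynomial ℚ_[p]} (hA0 : A ≠ 0) (hdeg : A.natDegree ≤ p)
    (hodd : A.comp (-Polynomial.X) = -A)
    (hODE : (Polynomial.derivative A * A.reflect p - A * Polynomial.derivative (A.reflect p)) ^ 2 *
        (1 - 2 * Polynomial.C (a : ℚ_[p]) * Polynomial.X ^ 2 + Polynomial.X ^ 4) =
      Polynomial.C ((p * c : ℤ_[p]) : ℚ_[p]) ^ 2 * (A.reflect p ^ 4 -
        2 * Polynomial.C (a : ℚ_[p]) * A ^ 2 * A.reflect p ^ 2 + A ^ 4)) :
    ∃ M D : Polynomial ℤ_[p], M.coeff p = 0 ∧ M.coeff 0 = 0 ∧ D.coeff 0 = 0 ∧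
      ∃ A B : Polynomial ℤ_[p], A = Polynomial.X ^ p + Polynomial.C (p : ℤ_[p]) * M ∧
      B = 1 + Polynomial.C (p : ℤ_[p]) * D ∧
      (Polynomial.derivative A * B - A * Polynomial.derivative B) ^ 2 *
        (1 - 2 * Polynomial.C a * Polynomial.X ^ 2 + Polynomial.X ^ 4) =
      Polynomial.C ((p : ℤ_[p]) * c) ^ 2 *
        (B ^ 4 - 2 * Polynomial.C a * A ^ 2 * B ^ 2 + A ^ 4) := by
  have hp : p.Prime := Fact.out
  obtain ⟨d, hd, A₀, hA₀, i, hi⟩ := PadicInt.exists_map_eq_C_mul hA0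
  have hinj : Function.Injective (Polynomial.map (PadicInt.Coe.ringHom (p := p))) :=
    Polynomial.map_injective _ Subtype.val_injective
  have hco (x : ℤ_[p]) : PadicInt.Coe.ringHom x = (x : ℚ_[p]) := rfl
  have hodd₀ : A₀.comp (-Polynomial.X) = -A₀ := by
    apply hinj
    rw [Polynomial.map_comp, Polynomial.map_neg, Polynomial.map_neg, Polynomial.map_X, hA₀,
      Polynomial.mul_comp, Polynomial.C_comp, hodd, mul_neg]
  have hdeg₀ : A₀.natDegree ≤ p := by
    rw [← Polynomial.natDegree_map_eq_of_injective
      (f := PadicInt.Coe.ringHom (p := p)) Subtype.val_injective, hA₀]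
    exact (Polynomial.natDegree_C_mul_le _ _).trans hdeg
  have hODE₀ : (Polynomial.derivative A₀ * A₀.reflect p -
      A₀ * Polynomial.derivative (A₀.reflect p)) ^ 2 *
        (1 - 2 * Polynomial.C a * Polynomial.X ^ 2 + Polynomial.X ^ 4) =
      Polynomial.C ((p : ℤ_[p]) * c) ^ 2 * (A₀.reflect p ^ 4 -
        2 * Polynomial.C a * A₀ ^ 2 * A₀.reflect p ^ 2 + A₀ ^ 4) := by
    apply hinj
    simp only [Polynomial.map_mul, Polynomial.map_sub, Polynomial.map_add, Polynomial.map_pow,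
      Polynomial.map_C, Polynomial.map_X, Polynomial.map_one, Polynomial.map_ofNat,
      ← Polynomial.derivative_map, ← Polynomial.reflect_map, hA₀, Polynomial.reflect_C_mul,
      Polynomial.derivative_C_mul, hco]
    linear_combination Polynomial.C d ^ 4 * hODE
  clear hODE hA₀ hdeg hodd hA0
  have hker (x : ℤ_[p]) (hx : PadicInt.toZMod x = 0) : (p : ℤ_[p]) ∣ x := by
    rwa [← RingHom.mem_ker, PadicInt.ker_toZMod, PadicInt.maximalIdeal_eq_span_p,
      Ideal.mem_span_singleton] at hx
  obtain ⟨e, he⟩ : ∃ e : ZMod p, A₀.map PadicInt.toZMod = Polynomial.C e * Polynomial.X ^ p := by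
    apply Polynomial.eq_C_mul_X_pow_of_wronskian_reflect_eq_zero hp2
    · intro h
      have := congrArg (fun q ↦ q.coeff i) h
      simp [hi] at this
    · exact Polynomial.natDegree_map_le.trans hdeg₀
    · rw [← Polynomial.map_neg, ← hodd₀, Polynomial.map_comp, Polynomial.map_neg, Polynomial.map_X]
    · have hp0 : PadicInt.toZMod ((p : ℤ_[p]) * c) = 0 := by simp
      have := congrArg (Polynomial.map PadicInt.toZMod) hODE₀
      simp only [Polynomial.map_mul, Polynomial.map_sub, Polynomial.map_add, Polynomial.map_pow,
        Polynomial.map_C, Polynomial.map_X, Polynomial.map_one, Polynomial.map_ofNat,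
        ← Polynomial.derivative_map, ← Polynomial.reflect_map, hp0,
        map_zero, zero_mul, zero_pow two_ne_zero] at this
      refine eq_zero_of_pow_eq_zero ((mul_eq_zero.1 this).resolve_right fun h ↦ ?_)
      have := congrArg (Polynomial.eval 0) h
      simp at this
  have hcoeff (j : ℕ) : PadicInt.toZMod (A₀.coeff j) = if j = p then e else 0 := by
    rw [← Polynomial.coeff_map, he, Polynomial.coeff_C_mul, Polynomial.coeff_X_pow]
    simp
  have hip : i = p := by
    by_contra h
    have := hcoeff i
    rw [hi, map_one, if_neg h] at this
    exact one_ne_zero this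
  subst hip
  obtain ⟨M, hM⟩ : Polynomial.C (i : ℤ_[i]) ∣ A₀ - Polynomial.X ^ i := by
    rw [Polynomial.C_dvd_iff_dvd_coeff]
    intro j
    rw [Polynomial.coeff_sub, Polynomial.coeff_X_pow]
    by_cases hj : j = i
    · simp [hj, hi]
    · rw [if_neg hj, sub_zero]
      exact hker _ (by rw [hcoeff, if_neg hj])
  have hA : A₀ = Polynomial.X ^ i + Polynomial.C (i : ℤ_[i]) * M := by rw [← hM]; ring
  have hi0 : (i : ℤ_[i]) ≠ 0 := Nat.cast_ne_zero.2 hp.ne_zero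
  have hMi : M.coeff i = 0 := by
    have := congrArg (fun q ↦ q.coeff i) hA
    simpa [hi, hp.ne_zero, -map_natCast] using this
  have hM0 : M.coeff 0 = 0 := by
    have h0 : A₀.coeff 0 = 0 := by
      have := congrArg (fun q ↦ q.coeff 0) hodd₀
      simp only [Polynomial.coeff_comp_neg_X', pow_zero, mul_one, Polynomial.coeff_neg] at this
      exact self_eq_neg.1 this
    have := congrArg (fun q ↦ q.coeff 0) hA
    simpa [h0, hp.ne_zero, hp.ne_zero.symm, -map_natCast] using this
  refine ⟨M, M.reflect i, hMi, hM0, by simpa [Polynomial.coeff_reflect, Polynomial.revAt_le] using hMi,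
    A₀, A₀.reflect i, hA, ?_, hODE₀⟩
  rw [hA, Polynomial.reflect_add, Polynomial.reflect_C_mul, Polynomial.reflect_monomial,
    Polynomial.revAt_le le_rfl, Nat.sub_self, pow_zero]

namespace PowerSeries

/-- The generating function of the central binomial coefficients. -/
lemma one_sub_four_mul_X_mul_centralBinom_sq :
    (1 - 4 * X) * (mk fun n ↦ (n.centralBinom : ℤ)) ^ 2 = (1 : PowerSeries ℤ) := by
  apply map_injective (Int.castRingHom ℚ) Int.cast_injective
  have h4 : (4 : PowerSeries ℚ) = C 4 := (map_ofNat C 4).symm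
  set G : PowerSeries ℚ := mk fun n ↦ (n.centralBinom : ℚ) with hG
  have hmap : map (Int.castRingHom ℚ) (mk fun n ↦ (n.centralBinom : ℤ)) = G := by
    ext n; simp [hG]
  have hODE : (1 - 4 * X) * derivative ℚ G = 2 * G := by
    rw [h4, show (2 : PowerSeries ℚ) = C 2 from (map_ofNat C 2).symm]
    ext n
    rw [sub_mul, one_mul, map_sub, mul_assoc, coeff_C_mul, coeff_C_mul, coeff_derivative]
    have h := Nat.succ_mul_centralBinom_succ n
    have h' : ((n : ℚ) + 1) * (n + 1).centralBinom = 2 * (2 * n + 1) * n.centralBinom := by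
      exact_mod_cast h
    cases n with
    | zero => simp [hG, Nat.centralBinom]
    | succ n =>
      rw [coeff_succ_X_mul, coeff_derivative]
      simp only [hG, coeff_mk]
      push_cast at h' ⊢
      linear_combination h'
  simp only [map_mul, map_pow, map_sub, map_ofNat, map_one, hmap, map_X]
  apply derivative.ext
  · rw [Derivation.leibniz, Derivation.leibniz_pow, map_sub, h4]
    have h1 : derivative ℚ (1 : PowerSeries ℚ) = 0 := Derivation.map_one_eq_zero _
    have h4X : derivative ℚ (C 4 * X : PowerSeries ℚ) = C 4 := by
      rw [Derivation.leibniz, derivative_C, derivative_X]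
      simp
    rw [h4X, h1, ← h4]
    simp only [smul_eq_mul]
    simp only [nsmul_eq_mul, Nat.cast_ofNat]
    linear_combination 2 * G * hODE
  · simp [hG]

lemma exists_coeff_eq_sum_centralBinom {R : Type*} [CommRing R] (μ : R) (n : ℕ) :
    ∃ Φ : PowerSeries R, constantCoeff Φ = 1 ∧
      X ^ (n + 1) ∣ Φ ^ 2 * ((1 - X) ^ 2 - 4 * C μ * X) - 1 ∧
      coeff n Φ = ∑ k ∈ range (n + 1), (k.centralBinom : R) * ((n + k).choose (2 * k)) * μ ^ k := by
  set P : Polynomial ℤ := trunc (n + 1) (mk fun n ↦ (n.centralBinom : ℤ)) with hP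
  have hPdvd : Polynomial.X ^ (n + 1) ∣ (1 - 4 * Polynomial.X) * P ^ 2 - 1 := by
    set G : PowerSeries ℤ := mk fun n ↦ (n.centralBinom : ℤ) with hG
    have h4 : ((4 : Polynomial ℤ) : PowerSeries ℤ) = 4 := by
      rw [show (4 : Polynomial ℤ) = Polynomial.C 4 from (map_ofNat Polynomial.C 4).symm,
        Polynomial.coe_C, map_ofNat]
    have h1 : X ^ (n + 1) ∣ G - (P : PowerSeries ℤ) := by
      rw [X_pow_dvd_iff]
      intro m hm
      rw [map_sub, Polynomial.coeff_coe, hP, coeff_trunc, if_pos hm, sub_self]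
    have h2 : X ^ (n + 1) ∣ ((((1 - 4 * Polynomial.X) * P ^ 2 - 1 : Polynomial ℤ)) : PowerSeries ℤ) := by
      obtain ⟨H, hH⟩ := h1
      have := one_sub_four_mul_X_mul_centralBinom_sq
      rw [← hG] at this
      simp only [Polynomial.coe_sub, Polynomial.coe_mul, Polynomial.coe_one, Polynomial.coe_X,
        Polynomial.coe_pow, h4]
      refine ⟨-(1 - 4 * X) * H * ((P : PowerSeries ℤ) + G), ?_⟩
      linear_combination this - (1 - 4 * X) * ((P : PowerSeries ℤ) + G) * hH
    rw [Polynomial.X_pow_dvd_iff]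
    rw [X_pow_dvd_iff] at h2
    intro d hd
    rw [← Polynomial.coeff_coe, h2 d hd]
  set U : PowerSeries R := mk 1 with hU
  have hU1 : U * (1 - X) = 1 := mk_one_mul_one_sub_eq_one R
  set x : PowerSeries R := C μ * X * U ^ 2 with hx
  have hPx : Polynomial.aeval x P = ∑ k ∈ range (n + 1), (k.centralBinom : PowerSeries R) * x ^ k := by
    rw [hP, Polynomial.aeval_def, eval₂_trunc_eq_sum_range]
    simp
  refine ⟨U * Polynomial.aeval x P, ?_, ?_, ?_⟩
  · rw [hPx, sum_range_succ']
    simp [hU, hx]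
  · obtain ⟨H, hH⟩ := hPdvd
    have := congrArg (Polynomial.aeval x) hH
    simp only [map_sub, map_mul, map_pow, map_one, Polynomial.aeval_X, map_ofNat] at this
    refine ⟨(C μ * U ^ 2) ^ (n + 1) * Polynomial.aeval x H, ?_⟩
    have e : X ^ (n + 1) * ((C μ * U ^ 2) ^ (n + 1) * Polynomial.aeval x H) =
        x ^ (n + 1) * Polynomial.aeval x H := by
      rw [← mul_assoc, ← mul_pow, hx]
      congr 2; ring
    rw [e, ← this, hx]
    linear_combination (1 + U * (1 - X)) * (Polynomial.aeval (C μ * X * U ^ 2) P) ^ 2 * hU1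
  · rw [hPx, mul_sum, map_sum]
    refine sum_congr rfl fun k hk ↦ ?_
    have hk' : k ≤ n := by simpa [Nat.lt_succ_iff] using hk
    have : U * ((k.centralBinom : PowerSeries R) * x ^ k) =
        C ((k.centralBinom : R) * μ ^ k) * (X ^ k * U ^ (2 * k + 1)) := by
      rw [hx, map_mul, map_pow, map_natCast]; ring
    rw [this, coeff_C_mul, coeff_X_pow_mul', if_pos hk', hU, mk_one_pow_eq_mk_choose_add, coeff_mk,
      show 2 * k + (n - k) = n + k by lia]
    ring

/-- The coefficients of `(1 + (2 + 4μ)X² + X⁴)^(-1/2)`. -/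
lemma exists_coeff_two_mul_eq_sum_centralBinom {R : Type*} [CommRing R] (μ : R) {n : ℕ}
    (hn : Even n) :
    ∃ Ψ : PowerSeries R, constantCoeff Ψ = 1 ∧
      X ^ (2 * n + 2) ∣ Ψ ^ 2 * (1 + C (2 + 4 * μ) * X ^ 2 + X ^ 4) - 1 ∧
      coeff (2 * n) Ψ =
        ∑ k ∈ range (n + 1), (k.centralBinom : R) * ((n + k).choose (2 * k)) * μ ^ k := by
  obtain ⟨Φ, h0, ⟨H, hH⟩, hc⟩ := exists_coeff_eq_sum_centralBinom μ n
  have hX : rescale (-1 : R) X = -X := by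
    ext m
    rw [coeff_rescale, map_neg, coeff_X]
    split_ifs with h <;> simp [h]
  have hC (t : R) : rescale (-1 : R) (C t) = C t := by
    ext m
    rw [coeff_rescale, coeff_C]
    split_ifs with h <;> simp [h]
  refine ⟨expand 2 two_ne_zero (rescale (-1 : R) Φ), ?_, ?_, ?_⟩
  · rw [constantCoeff_expand, ← coeff_zero_eq_constantCoeff_apply, coeff_rescale]
    simpa using h0
  · have := congrArg (fun q ↦ expand 2 two_ne_zero (rescale (-1 : R) q)) hH
    simp only [map_sub, map_mul, map_pow, map_one, map_ofNat, hX, hC, map_neg, expand_X,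
      expand_C] at this
    refine ⟨(-1) ^ (n + 1) * expand 2 two_ne_zero (rescale (-1 : R) H), ?_⟩
    rw [map_add, map_mul, map_ofNat, map_ofNat]
    rw [neg_pow, ← pow_mul] at this
    rw [show 2 * n + 2 = 2 * (n + 1) by ring]
    linear_combination this
  · rw [coeff_expand_mul, coeff_rescale, hn.neg_one_pow, one_mul, hc]

end PowerSeries

/-- For `p = 2n + 1` prime and `k ≤ n`, `16^k * binom(n+k, 2k) ≡ (-1)^k * binom(2k, k)` modulo
`p²`. -/
lemma sq_dvd_pow_mul_choose_sub_centralBinom {p n : ℕ} (hp : p.Prime) (hpn : p = 2 * n + 1) {k : ℕ}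
    (hk : k ≤ n) :
    (p : ℤ) ^ 2 ∣ 16 ^ k * (n + k).choose (2 * k) - (-1) ^ k * k.centralBinom := by
  induction k with
  | zero => simp
  | succ k ih =>
    obtain ⟨t, ht⟩ := ih (by lia)
    have h1 : ((n + k + 1 : ℕ) : ℤ) * (n + k).choose (2 * k + 1) =
        (n + (k + 1)).choose (2 * (k + 1)) * (2 * k + 1 + 1 : ℕ) := by
      exact_mod_cast Nat.add_one_mul_choose_eq (n + k) (2 * k + 1)
    have h2 : (((n + k).choose (2 * k + 1) : ℕ) : ℤ) * (2 * k + 1 : ℕ) =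
        (n + k).choose (2 * k) * (n - k) := by
      have := Nat.choose_succ_right_eq (n + k) (2 * k)
      rw [show n + k - 2 * k = n - k by lia] at this
      zify [show k ≤ n by lia] at this
      push_cast
      exact this
    have h3 : ((k : ℤ) + 1) * (k + 1).centralBinom = 2 * (2 * k + 1) * k.centralBinom := by
      exact_mod_cast Nat.succ_mul_centralBinom_succ k
    have hco : IsCoprime ((p : ℤ) ^ 2) ((2 * k + 2) * (2 * k + 1)) := by
      have hlt (m : ℕ) (h0 : 0 < m) (hm : m < p) : IsCoprime (p : ℤ) m :=
        Nat.isCoprime_iff_coprime.2 (Nat.coprime_of_lt_prime h0.ne' hm hp)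
      apply IsCoprime.pow_left
      exact IsCoprime.mul_right (by exact_mod_cast hlt (2 * k + 2) (by lia) (by lia))
        (by exact_mod_cast hlt (2 * k + 1) (by lia) (by lia))
    apply hco.dvd_of_dvd_mul_left
    have hp' : (p : ℤ) = 2 * n + 1 := by exact_mod_cast hpn
    refine ⟨4 * 16 ^ k * (n + k).choose (2 * k) - 4 * (2 * k + 1) ^ 2 * t, ?_⟩
    push_cast at h1 h2
    rw [pow_succ, pow_succ]
    generalize ((n + k).choose (2 * k + 1) : ℤ) = c₁ at *
    generalize ((n + (k + 1)).choose (2 * (k + 1)) : ℤ) = c₂ at *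
    generalize ((n + k).choose (2 * k) : ℤ) = c₀ at *
    rw [hp'] at ht ⊢
    linear_combination (-16 * 16 ^ k * (2 * k + 1)) * h1 + 16 * 16 ^ k * (n + k + 1) * h2 +
      2 * (2 * k + 1) * (-1) ^ k * h3 - 4 * (2 * k + 1) ^ 2 * ht

lemma sq_dvd_sum_centralBinom_sub {R : Type*} [CommRing R] {p n : ℕ} (hp : p.Prime)
    (hpn : p = 2 * n + 1) (h4 : IsUnit (4 : R)) (x : R) :
    (p : R) ^ 2 ∣ (∑ k ∈ range p, ((Nat.choose (2 * k) k : R) ^ 2 *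
        (x * Ring.inverse (4 : R)) ^ (2 * k))) -
      ∑ k ∈ range (n + 1), (k.centralBinom : R) * ((n + k).choose (2 * k)) * (-x ^ 2) ^ k := by
  have hi : 4 * Ring.inverse (4 : R) = 1 := Ring.mul_inverse_cancel _ h4
  rw [range_eq_Ico, range_eq_Ico, ← sum_Ico_consecutive _ (Nat.zero_le (n + 1)) (by lia : n + 1 ≤ p),
    add_sub_right_comm, ← sum_sub_distrib]
  refine dvd_add (dvd_sum fun k hk ↦ ?_) (dvd_sum fun k hk ↦ ?_)
  · have hk' : k ≤ n := by rw [mem_Ico] at hk; lia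
    obtain ⟨t, ht⟩ := sq_dvd_pow_mul_choose_sub_centralBinom hp hpn hk'
    have ht' := congrArg (Int.cast (R := R)) ht
    push_cast at ht'
    refine ⟨-(k.centralBinom : R) * t * (Ring.inverse 4 ^ 2) ^ k * (-x ^ 2) ^ k, ?_⟩
    have hi' : (16 : R) ^ k * (Ring.inverse 4 ^ 2) ^ k = 1 := by
      rw [← mul_pow, show (16 : R) = 4 ^ 2 by norm_num, ← mul_pow, hi, one_pow, one_pow]
    have hx : (-1 : R) ^ k * (-x ^ 2) ^ k = (x ^ 2) ^ k := by rw [← mul_pow]; ring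
    rw [pow_mul, mul_pow, mul_pow, ← Nat.centralBinom_eq_two_mul_choose, ← hx]
    generalize (-x ^ 2) ^ k = y at *
    generalize (Ring.inverse (4 : R) ^ 2) ^ k = z at *
    linear_combination (-(k.centralBinom : R) * z * y) * ht' +
      (k.centralBinom : R) * (n + k).choose (2 * k) * y * hi'
  · rw [mem_Ico] at hk
    apply Dvd.dvd.mul_right
    apply pow_dvd_pow_of_dvd
    apply Nat.cast_dvd_cast
    exact hp.dvd_choose (by lia) (by lia) (by lia)

section QuadraticCharSum

variable {k : Type*} [Field k] [Fintype k] [DecidableEq k]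

/-- The orbit of `z` under `z ↦ -z` and `z ↦ z⁻¹`. -/
lemma card_filter_sq_add_inv_sq_eq (h2 : (2 : k) ≠ 0) {z : k} (hz : z ≠ 0) (h1 : z ^ 2 ≠ 1)
    (h1' : z ^ 2 ≠ -1) :
    #{y : k | y ≠ 0 ∧ y ^ 2 + (y ^ 2)⁻¹ = z ^ 2 + (z ^ 2)⁻¹} = 4 := by
  have hset : ({y : k | y ≠ 0 ∧ y ^ 2 + (y ^ 2)⁻¹ = z ^ 2 + (z ^ 2)⁻¹} : Finset k) =
      {z, -z, z⁻¹, -z⁻¹} := by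
    ext y
    simp only [mem_filter, mem_univ, true_and, mem_insert, mem_singleton]
    constructor
    · rintro ⟨hy, h⟩
      have h' : ((y - z) * (y + z)) * ((y * z - 1) * (y * z + 1)) = 0 := by
        field_simp at h
        linear_combination h
      rcases mul_eq_zero.1 h' with h' | h' <;> rcases mul_eq_zero.1 h' with h' | h'
      · exact Or.inl (sub_eq_zero.1 h')
      · exact Or.inr (Or.inl (eq_neg_of_add_eq_zero_left h'))
      · exact Or.inr (Or.inr (Or.inl (eq_inv_of_mul_eq_one_left (sub_eq_zero.1 h'))))
      · refine Or.inr (Or.inr (Or.inr ?_))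
        rw [eq_neg_iff_add_eq_zero]
        field_simp
        rw [mul_zero, h']
    · rintro (rfl | rfl | rfl | rfl)
      · exact ⟨hz, rfl⟩
      · exact ⟨neg_ne_zero.2 hz, by rw [neg_sq]⟩
      · exact ⟨inv_ne_zero hz, by rw [inv_pow, inv_inv, add_comm]⟩
      · exact ⟨neg_ne_zero.2 (inv_ne_zero hz), by rw [neg_sq, inv_pow, inv_inv, add_comm]⟩
  have hneg (x : k) (hx : x ≠ 0) : x ≠ -x := fun h ↦ by
    have : 2 * x = 0 := by linear_combination h
    exact hx ((mul_eq_zero.1 this).resolve_left h2)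
  have e1 : z ≠ z⁻¹ := fun h ↦ h1 (by rw [sq]; nth_rw 2 [h]; exact mul_inv_cancel₀ hz)
  have e2 : z ≠ -z⁻¹ := fun h ↦ h1' (by
    rw [sq]; nth_rw 2 [h]; rw [mul_neg, mul_inv_cancel₀ hz])
  rw [hset, card_insert_of_notMem, card_insert_of_notMem, card_insert_of_notMem, card_singleton]
  · simpa using hneg _ (inv_ne_zero hz)
  · simp only [mem_insert, mem_singleton, not_or]
    exact ⟨fun h ↦ e2 (by rw [← h, neg_neg]), fun h ↦ e1 (neg_injective h)⟩
  · simp only [mem_insert, mem_singleton, not_or]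
    exact ⟨hneg _ hz, e1, e2⟩

lemma four_dvd_card_filter (h2 : (2 : k) ≠ 0) (P : k → Prop) [DecidablePred P] :
    4 ∣ #{z : k | (z ≠ 0 ∧ z ^ 2 ≠ 1 ∧ z ^ 2 ≠ -1) ∧ P (z ^ 2 + (z ^ 2)⁻¹)} := by
  rw [card_eq_sum_card_image (fun z : k ↦ z ^ 2 + (z ^ 2)⁻¹)]
  refine dvd_sum fun b hb ↦ ?_
  obtain ⟨z, hz, rfl⟩ := mem_image.1 hb
  simp only [mem_filter, mem_univ, true_and] at hz
  obtain ⟨⟨hz0, hz1, hz2⟩, hP⟩ := hz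
  rw [← card_filter_sq_add_inv_sq_eq h2 hz0 hz1 hz2]
  apply dvd_of_eq
  congr 1
  ext y
  simp only [mem_filter, mem_univ, true_and]
  constructor
  · rintro ⟨hy, h⟩
    have h' : (y ^ 2 - 1) ^ 2 * z ^ 2 = (z ^ 2 - 1) ^ 2 * y ^ 2 := by
      field_simp at h
      linear_combination h
    have h'' : (y ^ 2 + 1) ^ 2 * z ^ 2 = (z ^ 2 + 1) ^ 2 * y ^ 2 := by
      field_simp at h
      linear_combination h
    refine ⟨⟨⟨hy, fun h1 ↦ ?_, fun h1 ↦ ?_⟩, by rwa [h]⟩, h⟩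
    · rw [h1] at h'
      have : (z ^ 2 - 1) ^ 2 = 0 := by linear_combination -h'
      exact hz1 (sub_eq_zero.1 (pow_eq_zero_iff two_ne_zero |>.1 this))
    · rw [h1] at h''
      have : (z ^ 2 + 1) ^ 2 = 0 := by linear_combination h''
      exact hz2 (eq_neg_of_add_eq_zero_left (pow_eq_zero_iff two_ne_zero |>.1 this))
  · rintro ⟨⟨⟨hy, -⟩, -⟩, h⟩
    exact ⟨hy, h⟩

lemma sum_quadraticChar_quartic_modEq (hk : Fintype.card k % 8 = 1) {r : k} (hr : r ^ 2 = 2) :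
    ∑ z : k, quadraticChar k (1 - 2 * (5 - 4 * r) * z ^ 2 + z ^ 4) ≡ 5 [ZMOD 8] := by
  have h2 : (2 : k) ≠ 0 := Ring.two_ne_zero fun h ↦ by
    have := FiniteField.even_card_of_char_two h
    lia
  set f : k → k := fun z ↦ 1 - 2 * (5 - 4 * r) * z ^ 2 + z ^ 4 with hf
  set g : k → k := fun w ↦ w - 2 * (5 - 4 * r) with hg
  have hfg (z : k) (hz : z ≠ 0) : f z = z ^ 2 * g (z ^ 2 + (z ^ 2)⁻¹) := by
    simp only [hf, hg]
    field_simp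
    ring
  have hr1 : r - 1 ≠ 0 := fun h ↦ by
    rw [sub_eq_zero.1 h] at hr
    exact one_ne_zero (by linear_combination -hr : (1 : k) = 0)
  obtain ⟨i, hi⟩ : ∃ i : k, i ^ 2 = -1 := by
    obtain ⟨i, hi⟩ := FiniteField.isSquare_neg_one_iff.2 (by lia : Fintype.card k % 4 ≠ 3)
    exact ⟨i, by rw [hi, sq]⟩
  have h8 : (8 : k) * (r - 1) ≠ 0 := by
    rw [show (8 : k) = 2 ^ 3 by norm_num]
    exact mul_ne_zero (pow_ne_zero _ h2) hr1
  have hf1 (z : k) (hz : z ^ 2 = 1) : f z = 8 * (r - 1) := by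
    simp only [hf]; linear_combination (z ^ 2 + 1 - 2 * (5 - 4 * r)) * hz
  have hfi (z : k) (hz : z ^ 2 = -1) : f z = (2 * (r - 1)) ^ 2 := by
    simp only [hf]; linear_combination (z ^ 2 - 1 - 2 * (5 - 4 * r)) * hz - 4 * hr
  have hfi0 (z : k) (hz : z ^ 2 = -1) : quadraticChar k (f z) = 1 := by
    rw [hfi z hz]; exact quadraticChar_sq_one' (mul_ne_zero h2 hr1)
  have hf0 : f 0 = 1 := by simp [hf]
  have hterm (z : k) : quadraticChar k (f z) =
      1 - (if f z = 0 then 1 else 0) - 2 * (if quadraticChar k (f z) = -1 then 1 else 0) := by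
    by_cases h : f z = 0
    · simp [h]
    · rcases quadraticChar_dichotomy h with h' | h' <;> simp [h, h']
  have hsum : ∑ z : k, quadraticChar k (f z) =
      Fintype.card k - #{z : k | f z = 0} - 2 * #{z : k | quadraticChar k (f z) = -1} := by
    rw [sum_congr rfl fun z _ ↦ hterm z, sum_sub_distrib, sum_sub_distrib, ← mul_sum]
    simp
  -- the points where the character is `-1`
  have hneg : #{z : k | quadraticChar k (f z) = -1} % 4 =
      if quadraticChar k (8 * (r - 1)) = -1 then 2 else 0 := by
    have h4 := four_dvd_card_filter h2 (fun w ↦ quadraticChar k (g w) = -1)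
    have hsplit := card_filter_add_card_filter_not (s := {z : k | quadraticChar k (f z) = -1})
      (fun z ↦ z ^ 2 = 1)
    have e1 : filter (fun z ↦ ¬ z ^ 2 = 1) {z : k | quadraticChar k (f z) = -1} =
        ({z : k | (z ≠ 0 ∧ z ^ 2 ≠ 1 ∧ z ^ 2 ≠ -1) ∧
          quadraticChar k (g (z ^ 2 + (z ^ 2)⁻¹)) = -1} : Finset k) := by
      ext z
      simp only [mem_filter, mem_univ, true_and]
      constructor
      · rintro ⟨h, h'⟩
        have hz : z ≠ 0 := by rintro rfl; rw [hf0] at h; simp at h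
        refine ⟨⟨hz, h', fun h'' ↦ ?_⟩, ?_⟩
        · rw [hfi0 z h''] at h; simp at h
        · rwa [hfg z hz, map_mul, quadraticChar_sq_one' hz, one_mul] at h
      · rintro ⟨⟨hz, h', -⟩, h⟩
        exact ⟨by rwa [hfg z hz, map_mul, quadraticChar_sq_one' hz, one_mul], h'⟩
    have e2 : #(filter (fun z ↦ z ^ 2 = 1) {z : k | quadraticChar k (f z) = -1}) =
        if quadraticChar k (8 * (r - 1)) = -1 then 2 else 0 := by
      split_ifs with h
      · rw [show filter (fun z ↦ z ^ 2 = 1) {z : k | quadraticChar k (f z) = -1} =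
          ({1, -1} : Finset k) from ?_, card_pair]
        · intro h'
          exact h2 (by linear_combination h')
        · ext z
          simp only [mem_filter, mem_univ, true_and, mem_insert, mem_singleton]
          rw [← sq_eq_one_iff]
          exact ⟨fun h ↦ h.2, fun h' ↦ ⟨by rw [hf1 z h', h], h'⟩⟩
      · rw [card_eq_zero, filter_eq_empty_iff]
        intro z hz hz1
        simp only [mem_filter, mem_univ, true_and] at hz
        exact h (by rw [← hf1 z hz1, hz])
    rw [e1, e2] at hsplit
    split_ifs at hsplit ⊢ <;> lia
  -- the roots
  have hzero : #{z : k | f z = 0} = if quadraticChar k (8 * (r - 1)) = -1 then 0 else 4 := by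
    have hneg8 : quadraticChar k (8 * (r - 1)) = quadraticChar k (8 * (1 - r)) := by
      rw [show 8 * (r - 1) = i ^ 2 * (8 * (1 - r)) by rw [hi]; ring, map_mul,
        quadraticChar_sq_one' (by rintro rfl; simp at hi), one_mul]
    have hne (z : k) (h : f z = 0) : z ≠ 0 ∧ z ^ 2 ≠ 1 ∧ z ^ 2 ≠ -1 := by
      refine ⟨?_, fun h' ↦ ?_, fun h' ↦ ?_⟩
      · rintro rfl; rw [hf0] at h; exact one_ne_zero h
      · rw [hf1 z h'] at h; exact h8 h
      · rw [hfi z h'] at h; exact pow_ne_zero 2 (mul_ne_zero h2 hr1) h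
    split_ifs with h
    · rw [card_eq_zero, filter_eq_empty_iff]
      intro z _ hz
      rw [hneg8, quadraticChar_neg_one_iff_not_isSquare] at h
      obtain ⟨hz0, -⟩ := hne z hz
      refine h ⟨z - z⁻¹, ?_⟩
      simp only [hf] at hz
      field_simp
      linear_combination -hz
    · have hsq : IsSquare (8 * (1 - r)) := by
        rw [hneg8, quadraticChar_neg_one_iff_not_isSquare, not_not] at h
        exact h
      obtain ⟨e, he⟩ := hsq
      set z : k := (2 * (r - 1) + e) / 2 with hz
      have hfz : f z = 0 := by
        have h2z : 2 * z = 2 * (r - 1) + e := by rw [hz]; field_simp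
        have e' : z ^ 2 = 2 * (r - 1) * z - 1 := by
          have : 4 * (z ^ 2 - (2 * (r - 1) * z - 1)) = 0 := by
            linear_combination (2 * z - 2 * (r - 1) + e) * h2z - he - 4 * hr
          rw [show (4 : k) = 2 ^ 2 by norm_num] at this
          exact sub_eq_zero.1 ((mul_eq_zero.1 this).resolve_left (pow_ne_zero 2 h2))
        simp only [hf]
        linear_combination (z ^ 2 + 2 * (r - 1) * z + 1) * e' + 4 * z ^ 2 * hr
      obtain ⟨h0, h1, h1'⟩ := hne z hfz
      rw [← card_filter_sq_add_inv_sq_eq h2 h0 h1 h1']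
      congr 1
      ext y
      simp only [mem_filter, mem_univ, true_and]
      have hw (y : k) (hy : y ≠ 0) : f y = 0 ↔ y ^ 2 + (y ^ 2)⁻¹ = 2 * (5 - 4 * r) := by
        rw [hfg y hy, mul_eq_zero, or_iff_right (pow_ne_zero 2 hy), hg, sub_eq_zero]
      constructor
      · intro hy
        have hy0 := (hne y hy).1
        exact ⟨hy0, by rw [(hw y hy0).1 hy, (hw z h0).1 hfz]⟩
      · rintro ⟨hy0, h⟩
        rw [hw y hy0, h, (hw z h0).1 hfz]
  rw [hsum, hzero, Int.modEq_iff_dvd]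
  split_ifs at hneg ⊢ <;> lia

end QuadraticCharSum

/-- Truncated binomial expansion: `f ^ ((p-1)/2)` agrees with `f ^ (-1/2)` up to `X^p` in
characteristic `p`. -/
lemma PowerSeries.X_pow_dvd_pow_sub {R : Type*} [CommRing R] {p n : ℕ} [Fact p.Prime] [CharP R p]
    (hpn : p = 2 * n + 1) {f Ψ : PowerSeries R} (hΨ0 : constantCoeff Ψ = 1)
    (hΨ : X ^ p ∣ Ψ ^ 2 * f - 1) : X ^ p ∣ f ^ n - Ψ := by
  have : CharP (PowerSeries R) p :=
    charP_of_injective_ringHom (f := C) (PowerSeries.C_injective) p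
  have h1 : X ^ p ∣ Ψ ^ p - 1 := by
    have h : X ∣ Ψ - 1 := by rw [X_dvd_iff, map_sub, hΨ0, map_one, sub_self]
    have := pow_dvd_pow_of_dvd h p
    rwa [sub_pow_char, one_pow] at this
  have h2 : X ^ p ∣ Ψ ^ p * f ^ n - Ψ := by
    have h := hΨ.trans (sub_dvd_pow_sub_pow (Ψ ^ 2 * f) 1 n)
    have e : Ψ ^ p * f ^ n - Ψ = Ψ * ((Ψ ^ 2 * f) ^ n - 1 ^ n) := by
      rw [hpn, mul_pow, ← pow_mul, pow_succ, one_pow]; ring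
    rw [e]
    exact h.mul_left _
  have e : f ^ n - Ψ = (Ψ ^ p * f ^ n - Ψ) - f ^ n * (Ψ ^ p - 1) := by ring
  rw [e]
  exact dvd_sub h2 (h1.mul_left _)

lemma FiniteField.sum_pow_card_sub_one {k : Type*} [Field k] [Fintype k] {i : ℕ} (hi : i ≠ 0)
    (h : Fintype.card k - 1 ∣ i) : ∑ x : k, x ^ i = -1 := by
  classical
  rw [← FiniteField.sum_pow_units k i |>.trans (if_pos h),
    ← sum_erase_add univ _ (mem_univ (0 : k)), zero_pow hi, add_zero]
  symm
  refine sum_bij (fun (u : kˣ) _ ↦ (u : k)) ?_ ?_ ?_ ?_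
  · simp
  · intro _ _ _ _ h
    exact Units.ext h
  · intro b hb
    exact ⟨Units.mk0 b (mem_erase.1 hb).1, by simp, rfl⟩
  · simp

lemma FiniteField.sum_eval_of_natDegree_le {k : Type*} [Field k] [Fintype k] {F : Polynomial k}
    (hF : F.natDegree ≤ 2 * (Fintype.card k - 1)) :
    ∑ x : k, F.eval x =
      -F.coeff (Fintype.card k - 1) - F.coeff (2 * (Fintype.card k - 1)) := by
  set q := Fintype.card k with hq
  have hq1 : 1 < q := Fintype.one_lt_card
  have hsum (i : ℕ) (hi : i < 2 * (q - 1) + 1) :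
      ∑ x : k, x ^ i = (if i = q - 1 then -1 else 0) + (if i = 2 * (q - 1) then -1 else 0) := by
    by_cases h1 : i = q - 1
    · rw [if_pos h1, if_neg (by lia), add_zero]
      exact FiniteField.sum_pow_card_sub_one (by lia) (by rw [h1])
    by_cases h2 : i = 2 * (q - 1)
    · rw [if_neg h1, if_pos h2, zero_add]
      exact FiniteField.sum_pow_card_sub_one (by lia) (by rw [h2]; exact dvd_mul_left _ _)
    rw [if_neg h1, if_neg h2, add_zero]
    by_cases h3 : i < q - 1
    · exact FiniteField.sum_pow_lt_card_sub_one k i h3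
    · have h : ∀ x : k, x ^ i = x ^ (i - (q - 1)) := by
        intro x
        rw [show i = (i - q) + q by lia, pow_add, FiniteField.pow_card, ← pow_succ]
        congr 1; lia
      rw [sum_congr rfl fun x _ ↦ h x]
      exact FiniteField.sum_pow_lt_card_sub_one k _ (by lia)
  rw [sum_congr rfl fun x _ ↦ Polynomial.eval_eq_sum_range' (Nat.lt_succ_of_le hF) x, sum_comm,
    sum_congr rfl fun i hi ↦ by rw [← mul_sum, hsum i (mem_range.1 hi)]]
  simp only [mul_add, sum_add_distrib, mul_ite, mul_neg, mul_one, mul_zero, sum_ite_eq', mem_range]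
  rw [if_pos (by lia), if_pos (by lia)]
  ring

lemma sum_quadraticChar_quartic_eq {p n : ℕ} [Fact p.Prime] (hpn : p = 2 * n + 1) (a : ZMod p)
    {Ψ : PowerSeries (ZMod p)} (hΨ0 : PowerSeries.constantCoeff Ψ = 1)
    (hΨ : PowerSeries.X ^ p ∣ Ψ ^ 2 * (1 - 2 * PowerSeries.C a * PowerSeries.X ^ 2 +
      PowerSeries.X ^ 4) - 1) :
    ((∑ z : ZMod p, quadraticChar (ZMod p) (1 - 2 * a * z ^ 2 + z ^ 4) : ℤ) : ZMod p) =
      -1 - PowerSeries.coeff (p - 1) Ψ := by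
  set f : Polynomial (ZMod p) :=
    1 - 2 * Polynomial.C a * Polynomial.X ^ 2 + Polynomial.X ^ 4 with hf
  have hfc : (f : PowerSeries (ZMod p)) = 1 - 2 * PowerSeries.C a * PowerSeries.X ^ 2 +
      PowerSeries.X ^ 4 := by
    rw [hf, show (2 : Polynomial (ZMod p)) = Polynomial.C 2 from (map_ofNat Polynomial.C 2).symm,
      show (2 : PowerSeries (ZMod p)) = PowerSeries.C 2 from (map_ofNat PowerSeries.C 2).symm]
    simp only [Polynomial.coe_add, Polynomial.coe_sub, Polynomial.coe_mul, Polynomial.coe_one,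
      Polynomial.coe_C, Polynomial.coe_pow, Polynomial.coe_X]
  have hfd : f.natDegree ≤ 4 := by
    rw [hf, show (2 : Polynomial (ZMod p)) = Polynomial.C 2 from (map_ofNat Polynomial.C 2).symm]
    compute_degree
  have hf4 : f.coeff 4 = 1 := by
    rw [hf, show (2 : Polynomial (ZMod p)) = Polynomial.C 2 from (map_ofNat Polynomial.C 2).symm]
    compute_degree!
  have hring : ringChar (ZMod p) ≠ 2 := by rw [ZMod.ringChar_zmod_n]; lia
  have hterm (z : ZMod p) :
      ((quadraticChar (ZMod p) (1 - 2 * a * z ^ 2 + z ^ 4) : ℤ) : ZMod p) = (f ^ n).eval z := by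
    rw [quadraticChar_eq_pow_of_char_ne_two' hring, ZMod.card, show p / 2 = n by lia]
    simp [hf]
  push_cast
  rw [sum_congr rfl fun z _ ↦ hterm z, FiniteField.sum_eval_of_natDegree_le]
  · rw [ZMod.card, show 2 * (p - 1) = n * 4 by lia,
      Polynomial.coeff_pow_of_natDegree_le hfd, hf4, one_pow]
    have h := PowerSeries.X_pow_dvd_pow_sub hpn hΨ0 hΨ
    rw [← hfc, ← Polynomial.coe_pow, PowerSeries.X_pow_dvd_iff] at h
    have := h (p - 1) (by lia)
    rw [map_sub, Polynomial.coeff_coe] at this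
    linear_combination -this
  · rw [ZMod.card, show 2 * (p - 1) = n * 4 by lia]
    exact Polynomial.natDegree_pow_le_of_le n hfd

lemma PadicInt.isUnit_natCast_of_lt {p : ℕ} [hp : Fact p.Prime] {m : ℕ} (h0 : m ≠ 0) (hm : m < p) :
    IsUnit (m : ℤ_[p]) := by
  rw [PadicInt.isUnit_iff]
  refine le_antisymm (PadicInt.norm_le_one _) (not_lt.1 fun h ↦ ?_)
  rw [← Int.cast_natCast, PadicInt.norm_int_lt_one_iff_dvd] at h
  exact Nat.not_dvd_of_pos_of_lt (Nat.pos_of_ne_zero h0) hm (Int.natCast_dvd_natCast.1 h)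

/-- The sign in `∑ χ(1 - 2az² + z⁴) = -1 - 2ηu` is determined by `u` modulo `4`. -/
lemma mul_modEq_one_of_sum_quadraticChar {p : ℕ} [Fact p.Prime] (hp8 : p % 8 = 1) {u v η : ℤ}
    (huv : (p : ℤ) = u ^ 2 + 2 * v ^ 2) (hη : η = 1 ∨ η = -1) {r : ZMod p} (hr : r ^ 2 = 2)
    (h : ((∑ z : ZMod p, quadraticChar (ZMod p) (1 - 2 * (5 - 4 * r) * z ^ 2 + z ^ 4) : ℤ) :
      ZMod p) = -1 - η * (2 * u)) : η * u ≡ 1 [ZMOD 4] := by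
  have hp : p.Prime := Fact.out
  have hmod := sum_quadraticChar_quartic_modEq (k := ZMod p) (by rwa [ZMod.card]) hr
  have habs : |∑ z : ZMod p, quadraticChar (ZMod p) (1 - 2 * (5 - 4 * r) * z ^ 2 + z ^ 4)| ≤ p := by
    refine (abs_sum_le_sum_abs _ _).trans ?_
    refine (sum_le_card_nsmul _ _ 1 fun z _ ↦ ?_).trans (by simp [ZMod.card])
    by_cases hz : 1 - 2 * (5 - 4 * r) * z ^ 2 + z ^ 4 = 0
    · simp [hz]
    · rcases quadraticChar_dichotomy hz with h | h <;> simp [h]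
  generalize ∑ z : ZMod p, quadraticChar (ZMod p) (1 - 2 * (5 - 4 * r) * z ^ 2 + z ^ 4) = N at *
  have hdvd : (p : ℤ) ∣ N + 1 + 2 * (η * u) := by
    rw [← ZMod.intCast_zmod_eq_zero_iff_dvd]
    push_cast
    linear_combination h
  have hp17 : (17 : ℤ) ≤ p := by
    have h9 : p ≠ 9 := by rintro rfl; exact absurd hp (by norm_num)
    have := hp.one_lt
    lia
  have hu : |2 * (η * u)| + 1 < p := by
    have e : |2 * (η * u)| = 2 * |u| := by
      rcases hη with rfl | rfl <;> simp [abs_mul]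
    have : |u| ^ 2 ≤ p := by rw [sq_abs]; nlinarith
    rw [e]
    nlinarith [abs_nonneg u]
  obtain ⟨t, ht⟩ := hdvd
  have ht2 : (2 : ℤ) ∣ p * t := by
    rw [← ht]
    have := hmod.dvd
    lia
  obtain ⟨t', rfl⟩ : (2 : ℤ) ∣ t :=
    (Int.prime_two.dvd_mul.1 ht2).resolve_left fun h ↦ by lia
  have hlt : |(p : ℤ) * (2 * t')| < p * 2 := by
    rw [← ht]
    have := abs_add_le (N + 1) (2 * (η * u))
    have := abs_add_le N 1
    rw [abs_one] at this
    lia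
  have ht0 : t' = 0 := by
    rw [abs_mul, abs_mul, abs_of_pos (by lia : (0 : ℤ) < p), abs_two] at hlt
    have : |t'| < 1 := by nlinarith
    exact Int.abs_lt_one_iff.1 this
  rw [ht0] at ht
  have := hmod.dvd
  rw [Int.modEq_iff_dvd]
  lia

lemma eq_neg_one_pow_of_mul_modEq_one {u η : ℤ} (hη : η = 1 ∨ η = -1) (h : η * u ≡ 1 [ZMOD 4]) :
    η = (-1) ^ ((u - 1) / 2).natAbs := by
  have := h.dvd
  rcases hη with rfl | rfl
  · rw [Even.neg_one_pow]
    rw [Int.natAbs_even, Int.even_iff]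
    lia
  · rw [Odd.neg_one_pow]
    rw [Int.natAbs_odd, Int.odd_iff]
    lia

/-- The congruence for the coefficient of `X^(p-1)` in `(1 - 2(5 - 4√2)X² + X⁴)^(-1/2)`, up to
sign. -/
lemma PadicInt.exists_sq_dvd_coeff_sub {p : ℕ} [Fact p.Prime] (hp8 : p % 8 = 1) {u v : ℤ}
    {r s : ℤ_[p]} (hr : r ^ 2 = 2) (hs : s ^ 2 = -2) (huv : (p : ℤ) = u ^ 2 + 2 * v ^ 2)
    (hv : Even v) (hunit : IsUnit ((u : ℤ_[p]) + v * s)) {Ψ : PowerSeries ℤ_[p]}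
    (hΨ0 : PowerSeries.constantCoeff Ψ = 1)
    (hΨ : PowerSeries.X ^ p ∣ Ψ ^ 2 * (1 - 2 * PowerSeries.C (5 - 4 * r) * PowerSeries.X ^ 2 +
      PowerSeries.X ^ 4) - 1) :
    ∃ η : ℤ, (η = 1 ∨ η = -1) ∧
      (p : ℤ_[p]) ^ 2 ∣ PowerSeries.coeff (p - 1) Ψ - η * (u + v * s) := by
  have hp : p.Prime := Fact.out
  obtain ⟨c, hc⟩ := hunit.exists_right_inv
  have huv' : (p : ℤ_[p]) = u ^ 2 + 2 * v ^ 2 := by exact_mod_cast congrArg (Int.cast (R := ℤ_[p])) huv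
  have hπ : (u : ℤ_[p]) - v * s = p * c := by
    linear_combination ((v : ℤ_[p]) * s - u) * hc - v ^ 2 * c * hs - c * huv'
  have hsK : (s : ℚ_[p]) ^ 2 = -2 := by exact_mod_cast congrArg (Subtype.val) hs
  have hrK : (-(r : ℚ_[p])) ^ 2 = 2 := by
    rw [neg_sq]; exact_mod_cast congrArg (Subtype.val) hr
  obtain ⟨φ, -, hφ⟩ := Zsqrtd.exists_hom hsK
  have huodd : Odd u := by
    have h1 : Odd (u ^ 2 + 2 * v ^ 2) := by
      rw [← huv, Int.odd_iff]
      lia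
    rw [Int.odd_add] at h1
    exact (Int.odd_pow' two_ne_zero).1 (h1.2 (even_two_mul _))
  obtain ⟨A, hAdeg, hAodd, hA0, hAODE⟩ := exists_odd_polynomial' (φ := φ) hrK
    (π := ⟨u, -v⟩) (n := (p - 1) / 2) huodd hv.neg (by
      rw [Zsqrtd.norm_def]
      have : ((2 * ((p - 1) / 2) + 1 : ℕ) : ℤ) = p := by
        congr 1
        lia
      push_cast at this ⊢
      lia)
  rw [show 2 * ((p - 1) / 2) + 1 = p by lia] at hAdeg hAODE
  have hφπ : φ ⟨u, -v⟩ = ((p * c : ℤ_[p]) : ℚ_[p]) := by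
    rw [hφ, ← hπ]
    push_cast
    ring
  have ha : (5 + 4 * -(r : ℚ_[p])) = ((5 - 4 * r : ℤ_[p]) : ℚ_[p]) := by
    have h4 : ((4 : ℤ_[p]) : ℚ_[p]) = 4 := map_ofNat PadicInt.Coe.ringHom 4
    have h5 : ((5 : ℤ_[p]) : ℚ_[p]) = 5 := map_ofNat PadicInt.Coe.ringHom 5
    push_cast
    rw [h4, h5]
    ring
  rw [hφπ, ha] at hAODE
  obtain ⟨M, D, hM, hM0, hD0, A₁, B₁, hA₁, hB₁, hODE⟩ :=
    PadicInt.exists_eq_X_pow_add (by lia) hA0 hAdeg hAodd hAODE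
  have h2 : IsUnit (2 : ℤ_[p]) := by
    exact_mod_cast PadicInt.isUnit_natCast_of_lt (p := p) two_ne_zero (by have := hp.one_lt; lia)
  obtain ⟨c', hc', hdvd⟩ := exists_sq_eq_and_dvd_coeff hp.one_lt (Nat.cast_ne_zero.2 hp.ne_zero) h2
    (IsUnit.of_mul_eq_one_right _ hc) hM hM0 hD0 hA₁ hB₁ hODE hΨ0 hΨ
  have key (η : ℤ) (hη : η ^ 2 = 1) (h : c' = η * c) :
      (p : ℤ_[p]) ^ 2 ∣ PowerSeries.coeff (p - 1) Ψ - η * (u + v * s) := by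
    obtain ⟨t, ht⟩ := hdvd
    have hη' : (η : ℤ_[p]) ^ 2 = 1 := by exact_mod_cast congrArg (Int.cast (R := ℤ_[p])) hη
    refine ⟨η * (u + v * s) * t, ?_⟩
    rw [h] at ht
    linear_combination η * (u + v * s) * ht -
      η ^ 2 * PowerSeries.coeff (p - 1) Ψ * hc - PowerSeries.coeff (p - 1) Ψ * hη'
  rcases sq_eq_sq_iff_eq_or_eq_neg.1 hc' with h | h
  · exact ⟨1, Or.inl rfl, key 1 (by norm_num) (by rw [h]; simp)⟩
  · exact ⟨-1, Or.inr rfl, key (-1) (by norm_num) (by rw [h]; simp)⟩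

/-- For `p ≡ 1 mod 8`, `p = u² + 2v²` with `v` even and `u + v√-2` a `p`-adic unit,
`∑_{k<p} binom(2k,k)² ((1-√2)/4)^{2k} ≡ (-1)^((u-1)/2) (u + v√-2) mod p²`. -/
theorem stmt_4 (p : ℕ) [Fact p.Prime] (hp8 : p % 8 = 1) (u v : ℤ)
    (r : ℤ_[p]) (hr : r ^ 2 = 2) (s : ℤ_[p]) (hs : s ^ 2 = -2)
    (huv : (p : ℤ) = u ^ 2 + 2 * v ^ 2) (hv : Even v)
    (hunit : IsUnit ((u : ℤ_[p]) + v * s)) :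
    (p : ℤ_[p]) ^ 2 ∣
      (∑ k ∈ Finset.range p,
          ((Nat.choose (2 * k) k : ℤ_[p]) ^ 2 *
            ((1 - r) * Ring.inverse (4 : ℤ_[p])) ^ (2 * k)))
        - (-1 : ℤ_[p]) ^ ((u - 1) / 2).natAbs * ((u : ℤ_[p]) + v * s) := by
  have hp : p.Prime := Fact.out
  obtain ⟨n, hpn, hn⟩ : ∃ n, p = 2 * n + 1 ∧ Even n :=
    ⟨(p - 1) / 2, by lia, by rw [Nat.even_iff]; lia⟩
  have h4 : IsUnit (4 : ℤ_[p]) := by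
    exact_mod_cast PadicInt.isUnit_natCast_of_lt (p := p) four_ne_zero (by have := hp.one_lt; lia)
  obtain ⟨Ψ, hΨ0, hΨ, hΨc⟩ :=
    PowerSeries.exists_coeff_two_mul_eq_sum_centralBinom (-(1 - r) ^ 2) hn
  have hΨp : PowerSeries.X ^ p ∣ Ψ ^ 2 * (1 - 2 * PowerSeries.C (5 - 4 * r) *
      PowerSeries.X ^ 2 + PowerSeries.X ^ 4) - 1 := by
    refine (pow_dvd_pow _ (by lia : p ≤ 2 * n + 2)).trans ?_
    convert hΨ using 5
    rw [show 2 + 4 * -(1 - r) ^ 2 = -(2 * (5 - 4 * r)) by linear_combination -4 * hr]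
    rw [map_neg, map_mul, map_ofNat]
    ring
  obtain ⟨η, hη, hb⟩ := PadicInt.exists_sq_dvd_coeff_sub hp8 hr hs huv hv hunit hΨ0 hΨp
  have hsign : η * u ≡ 1 [ZMOD 4] := by
    have hr' : (PadicInt.toZMod r) ^ 2 = (2 : ZMod p) := by rw [← map_pow, hr, map_ofNat]
    refine mul_modEq_one_of_sum_quadraticChar hp8 huv hη hr' ?_
    obtain ⟨w, hw⟩ := hΨp
    have h := congrArg (PowerSeries.map (PadicInt.toZMod (p := p))) hw
    simp only [map_mul, map_sub, map_add, map_pow, map_one, map_ofNat, PowerSeries.map_X,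
      PowerSeries.map_C] at h
    rw [sum_quadraticChar_quartic_eq hpn _ (Ψ := PowerSeries.map PadicInt.toZMod Ψ)
      (by rw [← PowerSeries.coeff_zero_eq_constantCoeff_apply, PowerSeries.coeff_map,
        PowerSeries.coeff_zero_eq_constantCoeff_apply, hΨ0, map_one])
      ⟨PowerSeries.map PadicInt.toZMod w, by
        simp only [map_mul, map_sub, map_ofNat]; linear_combination h⟩, PowerSeries.coeff_map]
    obtain ⟨t, ht⟩ := hb
    have ht' := congrArg (PadicInt.toZMod (p := p)) ht
    have hnorm : (u + v * PadicInt.toZMod s) * (u - v * PadicInt.toZMod s) = 0 := by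
      have h1 := congrArg (Int.cast (R := ZMod p)) huv
      have h2 := congrArg (PadicInt.toZMod (p := p)) hs
      simp only [map_pow, map_neg, map_ofNat] at h2
      push_cast at h1
      rw [CharP.cast_eq_zero] at h1
      linear_combination -h1 - v ^ 2 * h2
    have hus : u - v * PadicInt.toZMod s = 0 := by
      have := hunit.map (PadicInt.toZMod (p := p))
      simp only [map_add, map_mul, map_intCast] at this
      exact this.mul_right_eq_zero.1 hnorm
    simp only [map_sub, map_mul, map_add, map_pow, map_natCast, map_intCast, CharP.cast_eq_zero,
      zero_pow two_ne_zero, zero_mul] at ht'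
    linear_combination -ht' + η * hus
  have hηpow := eq_neg_one_pow_of_mul_modEq_one hη hsign
  have hsum := sq_dvd_sum_centralBinom_sub hp hpn h4 (1 - r)
  rw [← hΨc, show 2 * n = p - 1 by lia] at hsum
  have := dvd_add hsum hb
  rwa [sub_add_sub_cancel, hηpow, Int.cast_pow, Int.cast_neg, Int.cast_one] at this
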